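/- arXiv:math-ph/0406015 — 3 statements merged into one kernel-verified Lean document; each statement's English description precedes it below -/
import Mathlib

section
/- There is a constant C > 0 such that A(n) ≤ C·(log n)² for all integers n > 2. -/
/-- Value of the integral binary quadratic form `(a,b,c)` at `(x,y)`. -/
def formVal (f : ℤ × ℤ × ℤ) (x y : ℤ) : ℤ := f.1 * x ^ 2 + f.2.1 * x * y + f.2.2 * y ^ 2

/-- A form `ax² + bxy + cy²` is primitive if `gcd(a,b,c) = 1`. -/
def IsPrimitiveForm (f : ℤ × ℤ × ℤ) : Prop := Int.gcd f.1 (Int.gcd f.2.1 f.2.2) = 1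

/-- Discriminant `b² − 4ac` of the form `(a,b,c)`. -/
def formDisc (f : ℤ × ℤ × ℤ) : ℤ := f.2.1 ^ 2 - 4 * f.1 * f.2.2

/-- `SL(2,ℤ)`-equivalence of binary quadratic forms:
`Q'(x,y) = Q(αx + βy, γx + δy)` for some `[[α,β],[γ,δ]] ∈ SL(2,ℤ)`. -/
def formEquiv (f g : ℤ × ℤ × ℤ) : Prop :=
  ∃ M : Matrix.SpecialLinearGroup (Fin 2) ℤ,
    ∀ x y : ℤ, formVal g x y =
      formVal f (M.1 0 0 * x + M.1 0 1 * y) (M.1 1 0 * x + M.1 1 1 * y)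

/-- The class number `h(d)`: the number of `SL(2,ℤ)`-equivalence classes of
primitive integral binary quadratic forms of discriminant `d`. -/
noncomputable def classNumber (d : ℤ) : ℕ :=
  Nat.card (Quot (fun f g : {f : ℤ × ℤ × ℤ // IsPrimitiveForm f ∧ formDisc f = d} =>
    formEquiv f.1 g.1))
/-- `t_d`: the least `t ≥ 1` such that `t² − d u² = 4` has a solution with `u ≥ 1`. -/
noncomputable def td (d : ℤ) : ℕ :=
  sInf {t : ℕ | 0 < t ∧ ∃ u : ℕ, 0 < u ∧ (t : ℤ) ^ 2 - d * (u : ℤ) ^ 2 = 4}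

/-- `u_d`: the positive `u` corresponding to `t_d`. -/
noncomputable def ud (d : ℤ) : ℕ :=
  sInf {u : ℕ | 0 < u ∧ (td d : ℤ) ^ 2 - d * (u : ℤ) ^ 2 = 4}

/-- `ε_d = (t_d + u_d √d)/2`, the fundamental solution of `t² − d u² = 4`. -/
noncomputable def eps (d : ℤ) : ℝ := ((td d : ℝ) + (ud d : ℝ) * Real.sqrt (d : ℝ)) / 2
/-- `A(n) = Σ h(d)·log(ε_d)/(u·√d)`, summed over pairs `(d,u)` of positive integers with
`d ≡ 0, 1 (mod 4)` and `d·u² = n² − 4`. -/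
noncomputable def ampA (n : ℕ) : ℝ :=
  ∑ p ∈ (Finset.range (n ^ 2) ×ˢ Finset.range (n ^ 2)).filter
      (fun p => 0 < p.1 ∧ 0 < p.2 ∧ (p.1 % 4 = 0 ∨ p.1 % 4 = 1) ∧ p.1 * p.2 ^ 2 = n ^ 2 - 4),
    (classNumber (p.1 : ℤ) : ℝ) * Real.log (eps (p.1 : ℤ)) /
      ((p.2 : ℝ) * Real.sqrt (p.1 : ℝ))

lemma rho_le (D : ℤ) (a : ℕ) (ha : 0 < a) :
    ((Finset.range (2 * a)).filter (fun b : ℕ => (4 * a : ℤ) ∣ (b : ℤ) ^ 2 - D)).card ≤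
      ∑ q ∈ a.divisorsAntidiagonal, Nat.gcd q.1 q.2 := by
  classical
  set S := (Finset.range (2 * a)).filter (fun b : ℕ => (4 * a : ℤ) ∣ (b : ℤ) ^ 2 - D) with hS
  rcases S.eq_empty_or_nonempty with h | ⟨b0, hb0⟩
  · rw [h]; simp
  have hb0' := (Finset.mem_filter.1 hb0).2
  have hsub : S ⊆ a.divisorsAntidiagonal.biUnion (fun q =>
      (Finset.range (2 * a)).filter (fun b : ℕ => ∃ z : ℤ, (b : ℤ) = b0 + 2 * z ∧
        (q.1 : ℤ) ∣ z ∧ (q.2 : ℤ) ∣ z + b0)) := by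
    intro b hb
    obtain ⟨hb1, hb2⟩ := Finset.mem_filter.1 hb
    have h1 : (4 * a : ℤ) ∣ ((b : ℤ) - b0) * (b + b0) := by
      have e : ((b : ℤ) - b0) * (b + b0) = ((b : ℤ) ^ 2 - D) - ((b0 : ℤ) ^ 2 - D) := by ring
      rw [e]; exact dvd_sub hb2 hb0'
    have hpar : (2 : ℤ) ∣ (b : ℤ) - b0 := by
      have h2 : (2 : ℤ) ∣ ((b : ℤ) - b0) * (b + b0) :=
        dvd_trans ⟨2 * a, by ring⟩ h1
      rcases Int.prime_two.dvd_or_dvd h2 with h | h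
      · exact h
      · have : (b : ℤ) - b0 = (b + b0) - 2 * b0 := by ring
        rw [this]; exact dvd_sub h ⟨_, rfl⟩
    obtain ⟨z, hz⟩ := hpar
    have hbz : (b : ℤ) = b0 + 2 * z := by linarith
    have h3 : (a : ℤ) ∣ z * (z + b0) := by
      have h4 : (4 * a : ℤ) ∣ 4 * (z * (z + b0)) := by
        convert h1 using 1
        rw [hbz]; ring
      exact (mul_dvd_mul_iff_left (by norm_num)).1 h4
    set g := Int.gcd (a : ℤ) z with hg
    have hgpos : 0 < g := Int.gcd_pos_of_ne_zero_left _ (by exact_mod_cast ha.ne')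
    have hga : (g : ℤ) ∣ a := Int.gcd_dvd_left ..
    have hgz : (g : ℤ) ∣ z := Int.gcd_dvd_right ..
    have hga' : g ∣ a := by exact_mod_cast hga
    obtain ⟨e, he⟩ := hga'
    rw [Finset.mem_biUnion]
    refine ⟨(g, e), ?_, ?_⟩
    · rw [Nat.mem_divisorsAntidiagonal]; exact ⟨he.symm, ha.ne'⟩
    · refine Finset.mem_filter.2 ⟨hb1, z, hbz, hgz, ?_⟩
      obtain ⟨w, hw⟩ := hgz
      have hcop : Int.gcd (e : ℤ) w = 1 := by
        have h5 : Int.gcd (g * (e : ℤ)) (g * w) = g * Int.gcd e w := by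
          rw [Int.gcd_mul_left]; simp
        have h6 : Int.gcd (g * (e : ℤ)) (g * w) = g := by
          rw [← hw]
          have : (g : ℤ) * e = a := by exact_mod_cast he.symm
          rw [this]
        rw [h6] at h5
        exact (Nat.eq_of_mul_eq_mul_left hgpos (by rw [mul_one]; exact h5)).symm
      have h7 : (e : ℤ) ∣ w * (z + b0) := by
        have h8 : (g : ℤ) * e ∣ g * (w * (z + b0)) := by
          have : (g : ℤ) * e = a := by exact_mod_cast he.symm
          rw [this, ← mul_assoc, ← hw]; exact h3
        exact (mul_dvd_mul_iff_left (by exact_mod_cast hgpos.ne')).1 h8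
      exact Int.dvd_of_dvd_mul_right_of_gcd_one h7 hcop
  refine (Finset.card_le_card hsub).trans (Finset.card_biUnion_le.trans ?_)
  refine Finset.sum_le_sum ?_
  rintro ⟨g1, g2⟩ hq
  rw [Nat.mem_divisorsAntidiagonal] at hq
  obtain ⟨hq, -⟩ := hq
  simp only at hq ⊢
  have hl : Nat.gcd g1 g2 * Nat.lcm g1 g2 = a := by rw [Nat.gcd_mul_lcm, hq]
  set g := Nat.gcd g1 g2
  set l := Nat.lcm g1 g2 with hlc
  have hlpos : 0 < l := Nat.pos_of_ne_zero (by rintro h; rw [h] at hl; omega)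
  calc _ ≤ (Finset.range g).card := by
        refine Finset.card_le_card_of_injOn (fun b => b / (2 * l)) ?_ ?_
        · intro b hb
          have := Finset.mem_range.1 (Finset.mem_filter.1 hb).1
          simp only [Finset.coe_range, Set.mem_Iio]
          rw [Nat.div_lt_iff_lt_mul (by omega)]
          calc b < 2 * a := this
            _ = g * (2 * l) := by rw [← hl]; ring
        · intro b hb b' hb' hbb
          obtain ⟨z, hz, hz1, hz2⟩ := (Finset.mem_filter.1 hb).2
          obtain ⟨z', hz', hz1', hz2'⟩ := (Finset.mem_filter.1 hb').2
          have e1 : (g1 : ℤ) ∣ z - z' := dvd_sub hz1 hz1'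
          have e2 : (g2 : ℤ) ∣ z - z' := by
            have e : z - z' = (z + b0) - (z' + b0) := by ring
            rw [e]; exact dvd_sub hz2 hz2'
          have e3 : (l : ℤ) ∣ z - z' := by
            have : ((Int.lcm g1 g2 : ℕ) : ℤ) ∣ z - z' := Int.coe_lcm_dvd e1 e2
            simpa [Int.lcm] using this
          have e4 : ((2 * l : ℕ) : ℤ) ∣ (b : ℤ) - b' := by
            have : (b : ℤ) - b' = 2 * (z - z') := by linarith
            rw [this]; push_cast
            exact mul_dvd_mul_left 2 e3
          have e5 : b' % (2 * l) = b % (2 * l) :=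
            (Nat.modEq_iff_dvd.2 e4)
          simp only at hbb
          rw [← Nat.div_add_mod b (2 * l), ← Nat.div_add_mod b' (2 * l), hbb, e5]
    _ = g := Finset.card_range g

lemma gcd_sum_le (X : ℕ) :
    ((∑ a ∈ Finset.Icc 1 X, ∑ q ∈ a.divisorsAntidiagonal, Nat.gcd q.1 q.2 : ℕ) : ℝ) ≤
      X * (1 + Real.log X) ^ 2 := by
  classical
  set H : ℝ := ∑ i ∈ Finset.Icc 1 X, (i : ℝ)⁻¹ with hH
  have hHle : H ≤ 1 + Real.log X := by
    have := harmonic_le_one_add_log X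
    rw [harmonic_eq_sum_Icc] at this
    push_cast at this
    exact this
  have hH0 : 0 ≤ H := Finset.sum_nonneg (fun i _ => by positivity)
  have key : ∑ a ∈ Finset.Icc 1 X, ∑ q ∈ a.divisorsAntidiagonal, Nat.gcd q.1 q.2 ≤
      ∑ g ∈ Finset.Icc 1 X, ∑ h ∈ Finset.Icc 1 X,
        g * ((Finset.Icc 1 X).filter (fun k => g ^ 2 * h * k ≤ X)).card := by
    have e1 : ∑ g ∈ Finset.Icc 1 X, ∑ h ∈ Finset.Icc 1 X,
        g * ((Finset.Icc 1 X).filter (fun k => g ^ 2 * h * k ≤ X)).card =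
        ∑ t ∈ (Finset.Icc 1 X ×ˢ Finset.Icc 1 X ×ˢ Finset.Icc 1 X).filter
          (fun t => t.1 ^ 2 * t.2.1 * t.2.2 ≤ X), t.1 := by
      rw [Finset.sum_filter, Finset.sum_product]
      refine Finset.sum_congr rfl fun g _ => ?_
      rw [Finset.sum_product]
      refine Finset.sum_congr rfl fun h _ => ?_
      rw [← Finset.sum_filter, Finset.sum_const, smul_eq_mul, mul_comm]
    rw [e1, Finset.sum_sigma']
    have hmem : ∀ x ∈ (Finset.Icc 1 X).sigma (fun a => a.divisorsAntidiagonal),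
        x.1 = x.2.1 * x.2.2 ∧ 0 < x.2.1 ∧ 0 < x.2.2 ∧ x.1 ≤ X := by
      rintro ⟨a, q1, q2⟩ hx
      simp only [Finset.mem_sigma, Finset.mem_Icc, Nat.mem_divisorsAntidiagonal] at hx ⊢
      obtain ⟨⟨h1, h2⟩, h3, h4⟩ := hx
      refine ⟨h3.symm, ?_, ?_, h2⟩
      · rcases Nat.eq_zero_or_pos q1 with h | h
        · subst h; simp at h3; omega
        · exact h
      · rcases Nat.eq_zero_or_pos q2 with h | h
        · subst h; simp at h3; omega
        · exact h
    let φ : (Σ _ : ℕ, ℕ × ℕ) → ℕ × ℕ × ℕ := fun x =>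
      (Nat.gcd x.2.1 x.2.2, x.2.1 / Nat.gcd x.2.1 x.2.2, x.2.2 / Nat.gcd x.2.1 x.2.2)
    have hinj : Set.InjOn φ ((Finset.Icc 1 X).sigma (fun a => a.divisorsAntidiagonal)) := by
      rintro ⟨a, q1, q2⟩ hx ⟨a', q1', q2'⟩ hx' hh
      have m1 := hmem _ hx
      have m2 := hmem _ hx'
      simp only [φ, Prod.mk.injEq] at hh m1 m2
      obtain ⟨h1, h2, h3⟩ := hh
      have k1 : q1 = q1' := by
        rw [← Nat.mul_div_cancel' (Nat.gcd_dvd_left q1 q2), h2, h1,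
          Nat.mul_div_cancel' (Nat.gcd_dvd_left q1' q2')]
      have k2 : q2 = q2' := by
        rw [← Nat.mul_div_cancel' (Nat.gcd_dvd_right q1 q2), h3, h1,
          Nat.mul_div_cancel' (Nat.gcd_dvd_right q1' q2')]
      subst k1 k2
      rw [m1.1, m2.1]
    rw [show (∑ x ∈ (Finset.Icc 1 X).sigma (fun a => a.divisorsAntidiagonal),
        Nat.gcd x.2.1 x.2.2) = ∑ t ∈ ((Finset.Icc 1 X).sigma
          (fun a => a.divisorsAntidiagonal)).image φ, t.1 by
      rw [Finset.sum_image hinj]]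
    refine Finset.sum_le_sum_of_subset ?_
    intro t ht
    obtain ⟨x, hx, rfl⟩ := Finset.mem_image.1 ht
    obtain ⟨m1, m2, m3, m4⟩ := hmem x hx
    have hgp : 0 < Nat.gcd x.2.1 x.2.2 := Nat.gcd_pos_of_pos_left _ m2
    have d1 := Nat.gcd_dvd_left x.2.1 x.2.2
    have d2 := Nat.gcd_dvd_right x.2.1 x.2.2
    have l1 : x.2.1 ≤ X := le_trans (by rw [m1]; exact Nat.le_mul_of_pos_right _ m3) m4
    have l2 : x.2.2 ≤ X := le_trans (by rw [m1]; exact Nat.le_mul_of_pos_left _ m2) m4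
    simp only [φ, Finset.mem_filter, Finset.mem_product, Finset.mem_Icc]
    refine ⟨⟨⟨hgp, (Nat.le_of_dvd m2 d1).trans l1⟩, ⟨Nat.div_pos (Nat.le_of_dvd m2 d1) hgp,
      (Nat.div_le_self _ _).trans l1⟩, ⟨Nat.div_pos (Nat.le_of_dvd m3 d2) hgp,
      (Nat.div_le_self _ _).trans l2⟩⟩, ?_⟩
    calc _ = (Nat.gcd x.2.1 x.2.2 * (x.2.1 / Nat.gcd x.2.1 x.2.2)) *
          (Nat.gcd x.2.1 x.2.2 * (x.2.2 / Nat.gcd x.2.1 x.2.2)) := by ring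
      _ = x.1 := by rw [Nat.mul_div_cancel' d1, Nat.mul_div_cancel' d2, m1]
      _ ≤ X := m4
  have cnt : ∀ g ∈ Finset.Icc 1 X, ∀ h ∈ Finset.Icc 1 X,
      (g : ℝ) * ((Finset.Icc 1 X).filter (fun k => g ^ 2 * h * k ≤ X)).card ≤
        X * ((g : ℝ)⁻¹ * (h : ℝ)⁻¹) := by
    intro g hg h hh
    have hg1 : 0 < g := (Finset.mem_Icc.1 hg).1
    have hh1 : 0 < h := (Finset.mem_Icc.1 hh).1
    have c1 : ((Finset.Icc 1 X).filter (fun k => g ^ 2 * h * k ≤ X)).card ≤ X / (g ^ 2 * h) := by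
      calc _ ≤ (Finset.Icc 1 (X / (g ^ 2 * h))).card := by
            refine Finset.card_le_card fun k hk => ?_
            simp only [Finset.mem_filter, Finset.mem_Icc] at hk ⊢
            refine ⟨hk.1.1, ?_⟩
            rw [Nat.le_div_iff_mul_le (by positivity), mul_comm]
            exact hk.2
        _ = _ := by simp
    have c2 : (((Finset.Icc 1 X).filter (fun k => g ^ 2 * h * k ≤ X)).card : ℝ) ≤
        X / ((g : ℝ) ^ 2 * h) := by
      calc _ ≤ ((X / (g ^ 2 * h) : ℕ) : ℝ) := by exact_mod_cast c1
        _ ≤ _ := by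
          have := @Nat.cast_div_le ℝ _ _ _ X (g ^ 2 * h)
          push_cast at this
          exact this
    have hgr : (0 : ℝ) < g := by exact_mod_cast hg1
    have hhr : (0 : ℝ) < h := by exact_mod_cast hh1
    calc _ ≤ (g : ℝ) * (X / ((g : ℝ) ^ 2 * h)) := by gcongr
      _ = _ := by field_simp
  calc ((∑ a ∈ Finset.Icc 1 X, ∑ q ∈ a.divisorsAntidiagonal, Nat.gcd q.1 q.2 : ℕ) : ℝ)
      ≤ ((∑ g ∈ Finset.Icc 1 X, ∑ h ∈ Finset.Icc 1 X,
        g * ((Finset.Icc 1 X).filter (fun k => g ^ 2 * h * k ≤ X)).card : ℕ) : ℝ) := by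
          exact_mod_cast key
    _ ≤ ∑ g ∈ Finset.Icc 1 X, ∑ h ∈ Finset.Icc 1 X, X * ((g : ℝ)⁻¹ * (h : ℝ)⁻¹) := by
        push_cast
        exact Finset.sum_le_sum fun g hg => Finset.sum_le_sum fun h hh => cnt g hg h hh
    _ = X * H ^ 2 := by
        rw [sq, hH, Finset.sum_mul_sum, Finset.mul_sum]
        refine Finset.sum_congr rfl fun g _ => ?_
        rw [Finset.mul_sum]
    _ ≤ _ := by gcongr

/-- Keys: normalized pairs `(a,b)` of forms of discriminant `D` with `|a| ≤ X`. -/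
noncomputable def keys (D : ℤ) (X : ℕ) : Finset (ℤ × ℕ) :=
  ((Finset.Icc (-(X : ℤ)) X) ×ˢ Finset.range (2 * X)).filter
    (fun k => k.1 ≠ 0 ∧ k.2 < 2 * k.1.natAbs ∧ 4 * k.1 ∣ (k.2 : ℤ) ^ 2 - D)

lemma mem_keys (D : ℤ) (X : ℕ) (k : ℤ × ℕ) : k ∈ keys D X ↔
    k.1.natAbs ≤ X ∧ k.1 ≠ 0 ∧ k.2 < 2 * k.1.natAbs ∧ 4 * k.1 ∣ (k.2 : ℤ) ^ 2 - D := by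
  simp only [keys, Finset.mem_filter, Finset.mem_product, Finset.mem_Icc, Finset.mem_range]
  constructor
  · rintro ⟨h1, h2⟩; exact ⟨by omega, h2⟩
  · rintro ⟨h1, h2⟩; exact ⟨by omega, h2⟩

lemma card_keys_le (D : ℤ) (X : ℕ) :
    ((keys D X).card : ℝ) ≤ 2 * (X * (1 + Real.log X) ^ 2) := by
  classical
  have h : (keys D X).card ≤
      2 * ∑ a ∈ Finset.Icc 1 X, ∑ q ∈ a.divisorsAntidiagonal, Nat.gcd q.1 q.2 := by
    have e : (keys D X).card ≤ ((Finset.univ : Finset Bool) ×ˢ (Finset.Icc 1 X).sigma (fun a =>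
        (Finset.range (2 * a)).filter (fun b : ℕ => (4 * a : ℤ) ∣ (b : ℤ) ^ 2 - D))).card := by
      refine Finset.card_le_card_of_injOn
        (fun k => (decide (0 < k.1), ⟨k.1.natAbs, k.2⟩)) ?_ ?_
      · rintro ⟨a, b⟩ hk
        have := (mem_keys D X (a, b)).1 hk
        simp only [Finset.coe_product, Finset.coe_univ, Finset.coe_sigma, Set.mem_prod,
          Set.mem_univ, true_and, Set.mem_sigma_iff, Finset.coe_Icc, Set.mem_Icc,
          Finset.mem_coe, Finset.mem_filter, Finset.mem_range] at this ⊢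
        refine ⟨by omega, this.2.2.1, ?_⟩
        have h4 := this.2.2.2
        rcases Int.natAbs_eq a with ha | ha
        · rw [← ha]; exact h4
        · have : (4 * (a.natAbs : ℤ)) = -(4 * a) := by omega
          rw [this]; exact (neg_dvd).2 h4
      · rintro ⟨a, b⟩ hk ⟨a', b'⟩ hk' hh
        simp only [Prod.mk.injEq, Sigma.mk.injEq, heq_eq_eq, decide_eq_decide] at hh ⊢
        exact ⟨by omega, hh.2.2⟩
    refine e.trans ?_
    rw [Finset.card_product, Finset.card_sigma]
    simp only [Finset.card_univ, Fintype.card_bool]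
    refine Nat.mul_le_mul_left 2 (Finset.sum_le_sum fun a ha => ?_)
    exact rho_le D a (Finset.mem_Icc.1 ha).1
  calc ((keys D X).card : ℝ) ≤ ((2 * ∑ a ∈ Finset.Icc 1 X,
        ∑ q ∈ a.divisorsAntidiagonal, Nat.gcd q.1 q.2 : ℕ) : ℝ) := by exact_mod_cast h
    _ ≤ _ := by
      rw [Nat.cast_mul]
      have := gcd_sum_le X
      norm_num
      push_cast at this
      linarith

/-- Weight of a key. -/
noncomputable def wt (X : ℕ) (k : ℤ × ℕ) : ℕ :=
  ((Finset.range (X + 1)).filter (fun i => 2 ^ i * k.1.natAbs ≤ X)).card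

lemma sum_wt_le (D : ℤ) (X : ℕ) (hX : 1 ≤ X) :
    ((∑ k ∈ keys D X, wt X k : ℕ) : ℝ) ≤ 4 * (X * (1 + Real.log X) ^ 2) := by
  classical
  have h1 : ∑ k ∈ keys D X, wt X k ≤ ∑ i ∈ Finset.range (X + 1), (keys D (X / 2 ^ i)).card := by
    simp only [wt, Finset.card_filter]
    rw [Finset.sum_comm]
    refine Finset.sum_le_sum fun i _ => ?_
    rw [← Finset.card_filter]
    refine Finset.card_le_card fun k hk => ?_
    obtain ⟨hk1, hk2⟩ := Finset.mem_filter.1 hk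
    rw [mem_keys] at hk1 ⊢
    refine ⟨?_, hk1.2⟩
    rw [Nat.le_div_iff_mul_le (by positivity), mul_comm]
    exact hk2
  have hlog : 0 ≤ Real.log X := Real.log_natCast_nonneg X
  have h2 : ∀ i, ((keys D (X / 2 ^ i)).card : ℝ) ≤
      2 * (X * (1 + Real.log X) ^ 2) * (1 / 2) ^ i := by
    intro i
    refine (card_keys_le D (X / 2 ^ i)).trans ?_
    have a1 : ((X / 2 ^ i : ℕ) : ℝ) ≤ X * (1 / 2) ^ i := by
      have := @Nat.cast_div_le ℝ _ _ _ X (2 ^ i)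
      refine this.trans (le_of_eq ?_)
      push_cast
      rw [one_div, inv_pow, div_eq_mul_inv]
    have a2 : Real.log ((X / 2 ^ i : ℕ) : ℝ) ≤ Real.log X := by
      rcases Nat.eq_zero_or_pos (X / 2 ^ i) with h | h
      · rw [h]; simpa using hlog
      · exact Real.log_le_log (by exact_mod_cast h) (by exact_mod_cast Nat.div_le_self _ _)
    have a3 : 0 ≤ Real.log ((X / 2 ^ i : ℕ) : ℝ) := Real.log_natCast_nonneg _
    calc 2 * (((X / 2 ^ i : ℕ) : ℝ) * (1 + Real.log ((X / 2 ^ i : ℕ) : ℝ)) ^ 2)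
        ≤ 2 * ((X * (1 / 2) ^ i) * (1 + Real.log X) ^ 2) := by gcongr
      _ = _ := by ring
  calc ((∑ k ∈ keys D X, wt X k : ℕ) : ℝ)
      ≤ ((∑ i ∈ Finset.range (X + 1), (keys D (X / 2 ^ i)).card : ℕ) : ℝ) := by exact_mod_cast h1
    _ ≤ ∑ i ∈ Finset.range (X + 1), 2 * (X * (1 + Real.log X) ^ 2) * (1 / 2) ^ i := by
        push_cast; exact Finset.sum_le_sum fun i _ => h2 i
    _ = 2 * (X * (1 + Real.log X) ^ 2) * ∑ i ∈ Finset.range (X + 1), (1 / 2 : ℝ) ^ i := by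
        rw [Finset.mul_sum]
    _ ≤ 2 * (X * (1 + Real.log X) ^ 2) * 2 := by
        gcongr
        exact sum_geometric_two_le _
    _ = _ := by ring

lemma not_sq_key (n : ℕ) (hn : 2 < n) (w : ℤ) : w ^ 2 ≠ (n : ℤ) ^ 2 - 4 := by
  intro h
  have hn' : (3 : ℤ) ≤ n := by exact_mod_cast hn
  have h1 : |w| ^ 2 = (n : ℤ) ^ 2 - 4 := by rw [sq_abs]; exact h
  have h0 := abs_nonneg w
  have h2 : |w| < n := by nlinarith
  have h3 : (n : ℤ) - 1 < |w| := by nlinarith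
  omega

lemma eps_spec (d n u : ℕ) (hn : 2 < n) (hd : 0 < d) (hu : 0 < u)
    (h : (n : ℤ) ^ 2 - d * (u : ℤ) ^ 2 = 4) :
    1 < eps d ∧ ∀ t v : ℤ, v ≠ 0 → t ^ 2 - d * v ^ 2 = 4 →
      eps d ≤ (|(t : ℝ)| + |(v : ℝ)| * Real.sqrt d) / 2 := by
  have hne : {t : ℕ | 0 < t ∧ ∃ u : ℕ, 0 < u ∧ (t : ℤ) ^ 2 - (d : ℤ) * (u : ℤ) ^ 2 = 4}.Nonempty :=
    ⟨n, by omega, u, hu, h⟩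
  have h1 := Nat.sInf_mem hne
  change 0 < td d ∧ ∃ u : ℕ, 0 < u ∧ (td d : ℤ) ^ 2 - (d : ℤ) * (u : ℤ) ^ 2 = 4 at h1
  obtain ⟨ht, hu1⟩ := h1
  have h2 := Nat.sInf_mem (s := {u : ℕ | 0 < u ∧ (td d : ℤ) ^ 2 - (d : ℤ) * (u : ℤ) ^ 2 = 4}) hu1
  change 0 < ud d ∧ (td d : ℤ) ^ 2 - (d : ℤ) * (ud d : ℤ) ^ 2 = 4 at h2
  obtain ⟨hu2, he⟩ := h2
  have hd1 : (1 : ℝ) ≤ d := by exact_mod_cast hd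
  have hs0 : 1 ≤ Real.sqrt d := by rw [Real.one_le_sqrt]; exact hd1
  have hsq : Real.sqrt d ^ 2 = d := Real.sq_sqrt (by positivity)
  have her : (td d : ℝ) ^ 2 - d * (ud d : ℝ) ^ 2 = 4 := by exact_mod_cast he
  have hur : (1 : ℝ) ≤ ud d := by exact_mod_cast hu2
  have htr : (0 : ℝ) < td d := by exact_mod_cast ht
  have hcast : eps d = ((td d : ℝ) + (ud d : ℝ) * Real.sqrt d) / 2 := by simp [eps]
  have hx : 1 ≤ (ud d : ℝ) * Real.sqrt d := by nlinarith
  refine ⟨?_, ?_⟩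
  · rw [hcast]
    have : 2 < (td d : ℝ) := by nlinarith
    linarith
  · intro t v hv htv
    have hvr : (t : ℝ) ^ 2 - d * (v : ℝ) ^ 2 = 4 := by exact_mod_cast htv
    have hle : td d ≤ t.natAbs := by
      apply Nat.sInf_le
      refine ⟨?_, v.natAbs, by omega, by simpa using htv⟩
      rw [Int.natAbs_pos]
      rintro rfl
      have : 0 ≤ (d : ℤ) * v ^ 2 := by positivity
      norm_num at htv
      omega
    have hle' : (td d : ℝ) ≤ |(t : ℝ)| := by
      have : ((t.natAbs : ℕ) : ℝ) = |(t : ℝ)| := by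
        rw [Nat.cast_natAbs]; push_cast; rfl
      rw [← this]; exact_mod_cast hle
    have hle2 : (ud d : ℝ) * Real.sqrt d ≤ |(v : ℝ)| * Real.sqrt d := by
      have e1 : ((ud d : ℝ) * Real.sqrt d) ^ 2 = (td d : ℝ) ^ 2 - 4 := by
        rw [mul_pow, hsq]; linarith
      have e2 : (|(v : ℝ)| * Real.sqrt d) ^ 2 = |(t : ℝ)| ^ 2 - 4 := by
        rw [mul_pow, hsq, sq_abs, sq_abs]; linarith
      have e3 : (td d : ℝ) ^ 2 ≤ |(t : ℝ)| ^ 2 := by gcongr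
      exact le_of_sq_le_sq (by linarith) (by positivity)
    rw [hcast]
    linarith

lemma autom (a b c α β γ δ : ℤ) (ha : a ≠ 0) (hp : IsPrimitiveForm (a, b, c))
    (hdet : α * δ - β * γ = 1)
    (hinv : ∀ x y, formVal (a, b, c) (α * x + β * y) (γ * x + δ * y) = formVal (a, b, c) x y) :
    ∃ t u : ℤ, t ^ 2 - (b ^ 2 - 4 * a * c) * u ^ 2 = 4 ∧ 2 * α = t - b * u ∧ γ = a * u ∧
      β = -(c * u) ∧ 2 * δ = t + b * u := by
  have i1 := hinv 1 0
  have i2 := hinv 0 1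
  have i3 := hinv 1 1
  simp only [formVal] at i1 i2 i3
  have j1 : a * α ^ 2 + b * α * γ + c * γ ^ 2 = a := by linear_combination i1
  have j2 : a * β ^ 2 + b * β * δ + c * δ ^ 2 = c := by linear_combination i2
  have j3 : 2 * a * α * β + b * (α * δ + β * γ) + 2 * c * γ * δ = b := by
    linear_combination i3 - i1 - i2
  have k1 : a * (δ - α) = b * γ := by
    have : 2 * (a * (δ - α) - b * γ) = 0 := by
      linear_combination (-2 * δ) * j1 + γ * j3 + (2 * a * α + b * γ) * hdet
    linarith
  have k2 : a * β = -(c * γ) := by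
    have : 2 * (a * β + c * γ) = 0 := by
      linear_combination (-2 * β) * j1 + α * j3 - (b * α + 2 * c * γ) * hdet
    linarith
  obtain ⟨u, hu⟩ : a ∣ γ := by
    have d1 : a ∣ b * γ := ⟨_, k1.symm⟩
    have d2 : a ∣ c * γ := ⟨-β, by linarith⟩
    have d3 : a ∣ (Int.gcd b c : ℤ) * γ := by
      rw [Int.gcd_eq_gcd_ab b c]
      have : (b * Int.gcdA b c + c * Int.gcdB b c) * γ =
        Int.gcdA b c * (b * γ) + Int.gcdB b c * (c * γ) := by ring
      rw [this]
      exact dvd_add (dvd_mul_of_dvd_right d1 _) (dvd_mul_of_dvd_right d2 _)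
    exact Int.dvd_of_dvd_mul_right_of_gcd_one d3 hp
  have m1 : δ - α = b * u := by
    apply mul_left_cancel₀ ha
    rw [k1, hu]; ring
  have m2 : β = -(c * u) := by
    apply mul_left_cancel₀ ha
    rw [k2, hu]; ring
  refine ⟨α + δ, u, ?_, by linarith, hu, m2, by linarith⟩
  have : (α + δ) ^ 2 = (δ - α) ^ 2 + 4 * (α * δ) := by ring
  rw [this, m1, show α * δ = 1 + β * γ by linarith, m2, hu]; ring

lemma normalise (f : ℤ × ℤ × ℤ) (p r : ℤ) (hc : IsCoprime p r) (h0 : formVal f p r ≠ 0) :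
    ∃ (q s : ℤ) (g : ℤ × ℤ × ℤ), p * s - q * r = 1 ∧
      (∀ x y, formVal g x y = formVal f (p * x + q * y) (r * x + s * y)) ∧
      g.1 = formVal f p r ∧ 0 ≤ g.2.1 ∧ g.2.1 < 2 * |g.1| := by
  obtain ⟨s, t, hst⟩ := hc
  obtain ⟨a, b, c⟩ := f
  set m := formVal (a, b, c) p r with hm
  let B : ℤ := 2 * a * p * (-t) + b * (p * s + (-t) * r) + 2 * c * r * s
  let k : ℤ := - (B / (2 * m))
  have hmod : B + 2 * m * k = B % (2 * m) := by
    have := Int.emod_def B (2 * m)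
    simp only [k]; linarith
  refine ⟨-t + k * p, s + k * r, (m, B + 2 * m * k, formVal (a, b, c) (-t + k * p) (s + k * r)),
    ?_, ?_, rfl, ?_, ?_⟩
  · linear_combination hst
  · intro x y
    simp only [formVal, hm, B]
    ring
  · change 0 ≤ B + 2 * m * k
    rw [hmod]
    exact Int.emod_nonneg _ (by omega)
  · change B + 2 * m * k < 2 * |m|
    rw [hmod]
    have := Int.emod_lt_abs B (b := 2 * m) (by omega)
    rwa [abs_mul] at this

lemma trans_facts (f g : ℤ × ℤ × ℤ) (p q r s : ℤ) (hdet : p * s - q * r = 1)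
    (hg : ∀ x y, formVal g x y = formVal f (p * x + q * y) (r * x + s * y))
    (hp : IsPrimitiveForm f) :
    formEquiv f g ∧ IsPrimitiveForm g ∧ formDisc g = formDisc f := by
  have hinv : ∀ x y, formVal f x y = formVal g (s * x - q * y) (-r * x + p * y) := by
    intro x y
    rw [hg]
    congr 1
    · linear_combination (-x) * hdet
    · linear_combination (-y) * hdet
  refine ⟨⟨⟨!![p, q; r, s], by rw [Matrix.det_fin_two_of]; exact hdet⟩, ?_⟩, ?_, ?_⟩
  · intro x y; simpa using hg x y
  · obtain ⟨a, b, c⟩ := f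
    obtain ⟨a', b', c'⟩ := g
    simp only [IsPrimitiveForm] at hp ⊢
    set e := Int.gcd a' (Int.gcd b' c') with he
    have e1 : (e : ℤ) ∣ a' := Int.gcd_dvd_left ..
    have e23 : (e : ℤ) ∣ (Int.gcd b' c' : ℤ) := Int.gcd_dvd_right ..
    have e2 : (e : ℤ) ∣ b' := e23.trans (Int.gcd_dvd_left ..)
    have e3 : (e : ℤ) ∣ c' := e23.trans (Int.gcd_dvd_right ..)
    have hv : ∀ x y, (e : ℤ) ∣ formVal (a, b, c) x y := by
      intro x y
      rw [hinv]
      simp only [formVal]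
      refine dvd_add (dvd_add (e1.mul_right _) ?_) (e3.mul_right _)
      rw [mul_assoc]; exact e2.mul_right _
    have v1 : (e : ℤ) ∣ a := by simpa [formVal] using hv 1 0
    have v2 : (e : ℤ) ∣ c := by simpa [formVal] using hv 0 1
    have v3 : (e : ℤ) ∣ b := by
      have h := dvd_sub (dvd_sub (hv 1 1) v1) v2
      have hh : formVal (a, b, c) 1 1 - a - c = b := by simp only [formVal]; ring
      rwa [hh] at h
    have : (e : ℤ) ∣ (Int.gcd a (Int.gcd b c) : ℤ) := Int.dvd_coe_gcd v1 (Int.dvd_coe_gcd v3 v2)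
    rw [hp] at this
    have h1 : e ∣ 1 := by exact_mod_cast this
    exact Nat.dvd_one.1 h1
  · have i1 := hg 1 0
    have i2 := hg 0 1
    have i3 := hg 1 1
    obtain ⟨a, b, c⟩ := f
    obtain ⟨a', b', c'⟩ := g
    simp only [formVal, formDisc] at i1 i2 i3 ⊢
    have j1 : a' = a * p ^ 2 + b * p * r + c * r ^ 2 := by linear_combination i1
    have j2 : c' = a * q ^ 2 + b * q * s + c * s ^ 2 := by linear_combination i2
    have j3 : b' = 2 * a * p * q + b * (p * s + q * r) + 2 * c * r * s := by
      linear_combination i3 - i1 - i2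
    rw [j1, j2, j3]
    linear_combination (b ^ 2 - 4 * a * c) * (p * s - q * r + 1) * hdet

/-- Approximation data at level `N` for the form `(a,b,c)`. -/
lemma approx (a b c : ℤ) (d : ℕ) (N : ℕ) (ha : a ≠ 0) (hd : 0 < d)
    (hdisc : b ^ 2 - 4 * a * c = d) (hN : a.natAbs ≤ N)
    (hnz : ∀ x y : ℤ, y ≠ 0 → formVal (a, b, c) x y ≠ 0) (θ θ' : ℝ)
    (hθ : θ = (-b + Real.sqrt d) / (2 * a)) (hθ' : θ' = (-b - Real.sqrt d) / (2 * a)) :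
    ∃ (p q r s : ℤ) (g : ℤ × ℤ × ℤ), p * s - q * r = 1 ∧
      (∀ x y, formVal g x y = formVal (a, b, c) (p * x + q * y) (r * x + s * y)) ∧
      g.1 ≠ 0 ∧ 0 ≤ g.2.1 ∧ g.2.1 < 2 * |g.1| ∧
      |(p : ℝ) - θ * r| * N ≤ 1 ∧ |(a : ℝ)| * |(p : ℝ) - θ' * r| ≤ 2 * Real.sqrt d * N ∧
      |(g.1 : ℝ)| = |(a : ℝ)| * |(p : ℝ) - θ * r| * |(p : ℝ) - θ' * r| := by
  have hapos : 0 < a.natAbs := Int.natAbs_pos.2 ha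
  have hNpos : 0 < N := by omega
  have har : (a : ℝ) ≠ 0 := by exact_mod_cast ha
  have hsq : Real.sqrt d ^ 2 = d := Real.sq_sqrt (by positivity)
  have hd1 : (1 : ℝ) ≤ d := by exact_mod_cast hd
  have hs1 : 1 ≤ Real.sqrt d := by rw [Real.one_le_sqrt]; exact hd1
  have hdr : (b : ℝ) ^ 2 - 4 * a * c = d := by exact_mod_cast hdisc
  obtain ⟨x, hx1, hx2⟩ := Real.exists_rat_abs_sub_le_and_den_le θ hNpos
  have hcop : IsCoprime x.num (x.den : ℤ) := by
    rw [Int.isCoprime_iff_gcd_eq_one]; exact x.reduced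
  have hden : (0 : ℝ) < x.den := by exact_mod_cast x.den_pos
  have hNr : (0 : ℝ) < N := by exact_mod_cast hNpos
  have hdN : (x.den : ℝ) ≤ N := by exact_mod_cast hx2
  have haN : |(a : ℝ)| ≤ N := by
    have : ((a.natAbs : ℕ) : ℝ) = |(a : ℝ)| := by rw [Nat.cast_natAbs]; push_cast; rfl
    rw [← this]; exact_mod_cast hN
  have h0 : formVal (a, b, c) x.num x.den ≠ 0 := hnz _ _ (by exact_mod_cast x.den_pos.ne')
  obtain ⟨q, s, g, h1, h2, h3, h4, h5⟩ := normalise (a, b, c) x.num x.den hcop h0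
  refine ⟨x.num, q, x.den, s, g, h1, h2, by rw [h3]; exact h0, h4, h5, ?_, ?_, ?_⟩
  · have e : |(x.num : ℝ) - θ * ((x.den : ℤ) : ℝ)| = |θ - x| * x.den := by
      conv_rhs => rw [← abs_of_pos hden, ← abs_mul, ← abs_neg]
      congr 1
      have : (x : ℝ) * x.den = x.num := by exact_mod_cast Rat.mul_den_eq_num x
      push_cast
      rw [sub_mul, this]; ring
    rw [e]
    calc |θ - x| * x.den * N ≤ 1 / ((N + 1) * x.den) * x.den * N := by gcongr
      _ = N / (N + 1) := by field_simp
      _ ≤ 1 := by rw [div_le_one (by positivity)]; linarith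
  · have e : |(x.num : ℝ) - θ * ((x.den : ℤ) : ℝ)| = |θ - x| * x.den := by
      conv_rhs => rw [← abs_of_pos hden, ← abs_mul, ← abs_neg]
      congr 1
      have : (x : ℝ) * x.den = x.num := by exact_mod_cast Rat.mul_den_eq_num x
      push_cast
      rw [sub_mul, this]; ring
    have e1 : |(x.num : ℝ) - θ * ((x.den : ℤ) : ℝ)| ≤ 1 := by
      rw [e]
      calc |θ - x| * x.den ≤ 1 / ((N + 1) * x.den) * x.den := by gcongr
        _ = 1 / (N + 1) := by field_simp
        _ ≤ 1 := by rw [div_le_one (by positivity)]; linarith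
    have e2 : (a : ℝ) * ((x.num : ℝ) - θ' * ((x.den : ℤ) : ℝ)) =
        a * ((x.num : ℝ) - θ * ((x.den : ℤ) : ℝ)) + Real.sqrt d * x.den := by
      rw [hθ, hθ']; push_cast; field_simp; ring
    rw [← abs_mul, e2]
    refine (abs_add_le _ _).trans ?_
    rw [abs_mul, abs_of_pos (show 0 < Real.sqrt d * x.den by positivity)]
    have f1 : |(a : ℝ)| * |(x.num : ℝ) - θ * ((x.den : ℤ) : ℝ)| ≤ N * 1 := by gcongr
    have f2 : Real.sqrt d * x.den ≤ Real.sqrt d * N := by gcongr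
    have f3 : (N : ℝ) * 1 ≤ Real.sqrt d * N := by nlinarith
    linarith
  · rw [h3, ← abs_mul, ← abs_mul]
    congr 1
    simp only [formVal]
    push_cast
    rw [hθ, hθ']
    field_simp
    linear_combination (-(x.den : ℝ) ^ 2) * hdr + (x.den : ℝ) ^ 2 * hsq

lemma compare (a b c : ℤ) (d n u : ℕ) (hn : 2 < n) (hd : 0 < d) (hu : 0 < u) (ha : a ≠ 0)
    (hpr : IsPrimitiveForm (a, b, c)) (hdisc : b ^ 2 - 4 * a * c = d)
    (hnu : (n : ℤ) ^ 2 - d * (u : ℤ) ^ 2 = 4) (θ θ' : ℝ)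
    (hθ : θ = (-b + Real.sqrt d) / (2 * a)) (hθ' : θ' = (-b - Real.sqrt d) / (2 * a))
    (g : ℤ × ℤ × ℤ) (p q r s p0 q0 r0 s0 : ℤ) (h1 : p * s - q * r = 1)
    (h10 : p0 * s0 - q0 * r0 = 1)
    (h2 : ∀ x y, formVal g x y = formVal (a, b, c) (p * x + q * y) (r * x + s * y))
    (h20 : ∀ x y, formVal g x y = formVal (a, b, c) (p0 * x + q0 * y) (r0 * x + s0 * y)) :
    |(p0 : ℝ) - θ * r0| ≤ |(p : ℝ) - θ * r| ∨
      eps d * |(p0 : ℝ) - θ' * r0| ≤ |(p : ℝ) - θ' * r| := by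
  have har : (a : ℝ) ≠ 0 := by exact_mod_cast ha
  have hsq : Real.sqrt d ^ 2 = d := Real.sq_sqrt (by positivity)
  have hdr : (b : ℝ) ^ 2 - 4 * a * c = d := by exact_mod_cast hdisc
  have hs0 : 0 ≤ Real.sqrt d := Real.sqrt_nonneg _
  obtain ⟨-, heps⟩ := eps_spec d n u hn hd hu hnu
  obtain ⟨t, v, htv, k1, k2, k3, k4⟩ := autom a b c (p * s0 - q * r0) (-p * q0 + q * p0)
    (r * s0 - s * r0) (-r * q0 + s * p0) ha hpr
    (by linear_combination (p0 * s0 - q0 * r0) * h1 + h10) (by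
      intro x y
      have e1 := h2 (s0 * x - q0 * y) (-r0 * x + p0 * y)
      rw [h20] at e1
      have e2 : p0 * (s0 * x - q0 * y) + q0 * (-r0 * x + p0 * y) = x := by
        linear_combination x * h10
      have e3 : r0 * (s0 * x - q0 * y) + s0 * (-r0 * x + p0 * y) = y := by
        linear_combination y * h10
      rw [e2, e3] at e1
      rw [e1]
      congr 1 <;> ring)
  rw [hdisc] at htv
  have hp' : p = (p * s0 - q * r0) * p0 + (-p * q0 + q * p0) * r0 := by
    linear_combination (-p) * h10
  have hr' : r = (r * s0 - s * r0) * p0 + (-r * q0 + s * p0) * r0 := by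
    linear_combination (-r) * h10
  have hp2 : 2 * p = (t - b * v) * p0 + 2 * -(c * v) * r0 := by
    rw [← k1, ← k3]; linear_combination 2 * hp'
  have hr2 : 2 * r = 2 * (a * v) * p0 + (t + b * v) * r0 := by
    rw [← k2, ← k4]; linear_combination 2 * hr'
  have hp3 : 2 * (p : ℝ) = (t - b * v) * p0 + 2 * -(c * v) * r0 := by exact_mod_cast hp2
  have hr3 : 2 * (r : ℝ) = 2 * (a * v) * p0 + (t + b * v) * r0 := by exact_mod_cast hr2
  have htvr : (t : ℝ) ^ 2 - d * (v : ℝ) ^ 2 = 4 := by exact_mod_cast htv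
  have hc : (c : ℝ) = (b ^ 2 - d) / (4 * a) := by field_simp; linarith
  have x1 : (p : ℝ) - θ * r = (t - v * Real.sqrt d) / 2 * (p0 - θ * r0) := by
    have : 2 * ((p : ℝ) - θ * r) = 2 * ((t - v * Real.sqrt d) / 2 * (p0 - θ * r0)) := by
      rw [mul_sub, mul_left_comm, hp3, hr3, hθ, hc]
      field_simp
      linear_combination (-4 * (v : ℝ) * r0) * hsq
    linarith
  have x2 : (p : ℝ) - θ' * r = (t + v * Real.sqrt d) / 2 * (p0 - θ' * r0) := by
    have : 2 * ((p : ℝ) - θ' * r) = 2 * ((t + v * Real.sqrt d) / 2 * (p0 - θ' * r0)) := by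
      rw [mul_sub, mul_left_comm, hp3, hr3, hθ', hc]
      field_simp
      linear_combination (-4 * (v : ℝ) * r0) * hsq
    linarith
  rw [x1, x2, abs_mul, abs_mul]
  by_cases hv : v = 0
  · left
    subst hv
    have ht4 : |(t : ℝ)| = 2 := by
      have : |(t : ℝ)| ^ 2 = 2 ^ 2 := by rw [sq_abs]; norm_num at htvr; linarith
      exact (sq_eq_sq₀ (abs_nonneg _) (by norm_num)).1 this
    have : |((t : ℝ) - (0 : ℤ) * Real.sqrt d) / 2| = 1 := by
      rw [abs_div]; simp [ht4]
    rw [this, one_mul]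
  · have he := heps t v hv htv
    have hpq : |(t : ℝ) - v * Real.sqrt d| * |(t : ℝ) + v * Real.sqrt d| = 4 := by
      rw [← abs_mul, show ((t : ℝ) - v * Real.sqrt d) * (t + v * Real.sqrt d) = 4 by
        linear_combination htvr - (v : ℝ) ^ 2 * hsq]
      norm_num
    have hmax : |(t : ℝ) - v * Real.sqrt d| = |(t : ℝ)| + |(v : ℝ)| * Real.sqrt d ∨
        |(t : ℝ) + v * Real.sqrt d| = |(t : ℝ)| + |(v : ℝ)| * Real.sqrt d := by
      have hva : |(v : ℝ)| * Real.sqrt d = |(v : ℝ) * Real.sqrt d| := by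
        rw [abs_mul, abs_of_nonneg hs0]
      rw [hva]
      generalize (v : ℝ) * Real.sqrt d = w
      rcases abs_cases (t : ℝ) with h | h <;> rcases abs_cases w with h' | h'
      · right; rw [h.1, h'.1, abs_of_nonneg (by linarith)]
      · left; rw [h.1, h'.1, abs_of_nonneg (by linarith)]; ring
      · left; rw [h.1, h'.1, abs_of_nonpos (by linarith)]; ring
      · right; rw [h.1, h'.1, abs_of_nonpos (by linarith)]; ring
    have hge := (eps_spec d n u hn hd hu hnu).1
    rcases hmax with h | h
    · left
      rw [abs_div, h, abs_two]
      exact le_mul_of_one_le_left (abs_nonneg _) (by linarith)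
    · right
      rw [abs_div, h, abs_two]
      gcongr

/-- The form class of `f` (scaled by `u`) contains the key `k`. -/
def KeyRel (f : ℤ × ℤ × ℤ) (d u : ℕ) (k : ℤ × ℕ) : Prop :=
  ∃ g : ℤ × ℤ × ℤ, IsPrimitiveForm g ∧ formDisc g = d ∧ formEquiv f g ∧
    k.1 = u * g.1 ∧ (k.2 : ℤ) = u * g.2.1

open Classical in
lemma class_bound (a b c : ℤ) (d n u : ℕ) (hn : 2 < n) (hd : 0 < d) (hu : 0 < u)
    (hpr : IsPrimitiveForm (a, b, c)) (hdisc : b ^ 2 - 4 * a * c = d)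
    (hnu : (n : ℤ) ^ 2 - d * (u : ℤ) ^ 2 = 4) (J : ℕ) (hJ : (2 : ℝ) ^ J < 2 * eps d) :
    J ≤ ∑ k ∈ (keys ((n : ℤ) ^ 2 - 4) (2 * n)).filter (KeyRel (a, b, c) d u),
      2 * wt (2 * n) k := by
  have ha : a ≠ 0 := by
    rintro rfl
    apply not_sq_key n hn (u * b)
    rw [mul_pow]; linear_combination (-hnu) + (u : ℤ) ^ 2 * hdisc
  have hnz : ∀ x y : ℤ, y ≠ 0 → formVal (a, b, c) x y ≠ 0 := by
    intro x y hy h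
    have h1 : (u * (2 * a * x + b * y)) ^ 2 = ((n : ℤ) ^ 2 - 4) * y ^ 2 := by
      simp only [formVal] at h
      linear_combination (4 * a * u ^ 2 : ℤ) * h + (u : ℤ) ^ 2 * y ^ 2 * hdisc - y ^ 2 * hnu
    have h2 : y ∣ u * (2 * a * x + b * y) := by
      rw [← Int.pow_dvd_pow_iff two_ne_zero, h1]
      exact dvd_mul_left _ _
    obtain ⟨w, hw⟩ := h2
    apply not_sq_key n hn w
    rw [hw, mul_pow, mul_comm] at h1
    exact mul_right_cancel₀ (pow_ne_zero 2 hy) h1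
  set θ : ℝ := (-b + Real.sqrt d) / (2 * a) with hθ
  set θ' : ℝ := (-b - Real.sqrt d) / (2 * a) with hθ'
  have happ := fun j : ℕ => approx a b c d (a.natAbs * 2 ^ j) ha hd hdisc
    (Nat.le_mul_of_pos_right _ (by positivity)) hnz θ θ' hθ hθ'
  choose p q r s g h1 h2 h3 h4 h5 h6 h7 h8 using happ
  have hA : (0 : ℝ) < a.natAbs := by exact_mod_cast Int.natAbs_pos.2 ha
  have hs0 : 0 ≤ Real.sqrt d := Real.sqrt_nonneg _
  have hsq : Real.sqrt d ^ 2 = d := Real.sq_sqrt (by positivity)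
  have hur : (0 : ℝ) < u := by exact_mod_cast hu
  have hus : (u : ℝ) * Real.sqrt d ≤ n := by
    have hnur : (n : ℝ) ^ 2 - d * (u : ℝ) ^ 2 = 4 := by exact_mod_cast hnu
    refine le_of_sq_le_sq ?_ (by positivity)
    rw [mul_pow, hsq]; linarith
  have heps := (eps_spec d n u hn hd hu hnu).1
  have hfacts := fun j => trans_facts (a, b, c) (g j) _ _ _ _ (h1 j) (h2 j) hpr
  have hdg : ∀ j, formDisc (g j) = d := fun j => by rw [(hfacts j).2.2]; exact hdisc
  let key : ℕ → ℤ × ℕ := fun j => (u * (g j).1, (u * (g j).2.1).toNat)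
  have hk2 : ∀ j, ((key j).2 : ℤ) = u * (g j).2.1 := fun j =>
    Int.toNat_of_nonneg (mul_nonneg (by positivity) (h4 j))
  -- conversion of real estimates
  have conv : ∀ j i : ℕ, (2 : ℝ) ^ i * |((g j).1 : ℝ)| ≤ 2 * Real.sqrt d →
      i ∈ (Finset.range (2 * n + 1)).filter (fun i => 2 ^ i * (key j).1.natAbs ≤ 2 * n) := by
    intro j i hi
    have e : 2 ^ i * (key j).1.natAbs ≤ 2 * n := by
      have : ((2 ^ i * (key j).1.natAbs : ℕ) : ℝ) ≤ ((2 * n : ℕ) : ℝ) := by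
        push_cast
        rw [Nat.cast_natAbs]
        simp only [key]
        push_cast
        rw [abs_mul, abs_of_pos hur]
        calc (2 : ℝ) ^ i * (u * |((g j).1 : ℝ)|) = u * (2 ^ i * |((g j).1 : ℝ)|) := by ring
          _ ≤ u * (2 * Real.sqrt d) := by gcongr
          _ = 2 * (u * Real.sqrt d) := by ring
          _ ≤ 2 * n := by gcongr
      exact_mod_cast this
    refine Finset.mem_filter.2 ⟨Finset.mem_range.2 ?_, e⟩
    have hpos : 0 < (key j).1.natAbs := by
      rw [Int.natAbs_pos]
      exact mul_ne_zero (by exact_mod_cast hu.ne') (h3 j)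
    have : i < 2 ^ i := Nat.lt_two_pow_self
    have : 2 ^ i ≤ 2 ^ i * (key j).1.natAbs := Nat.le_mul_of_pos_right _ hpos
    omega
  have base : ∀ j, |((g j).1 : ℝ)| ≤ 2 * Real.sqrt d := by
    intro j
    have e6 := h6 j
    have e7 := h7 j
    rw [h8 j]
    calc |(a : ℝ)| * |(p j : ℝ) - θ * r j| * |(p j : ℝ) - θ' * r j|
        = |(p j : ℝ) - θ * r j| * (|(a : ℝ)| * |(p j : ℝ) - θ' * r j|) := by ring
      _ ≤ |(p j : ℝ) - θ * r j| * (2 * Real.sqrt d * (a.natAbs * 2 ^ j : ℕ)) := by gcongr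
      _ = (|(p j : ℝ) - θ * r j| * (a.natAbs * 2 ^ j : ℕ)) * (2 * Real.sqrt d) := by ring
      _ ≤ 1 * (2 * Real.sqrt d) := by gcongr
      _ = _ := one_mul _
  have hmaps : Set.MapsTo key (Finset.range J)
      ((keys ((n : ℤ) ^ 2 - 4) (2 * n)).filter (KeyRel (a, b, c) d u)) := by
    intro j _
    rw [Finset.mem_coe, Finset.mem_filter, mem_keys]
    refine ⟨⟨?_, ?_, ?_, ?_⟩, g j, (hfacts j).2.1, hdg j, (hfacts j).1, rfl, hk2 j⟩
    · have := (Finset.mem_filter.1 (conv j 0 (by simpa using base j))).2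
      simpa using this
    · exact mul_ne_zero (by exact_mod_cast hu.ne') (h3 j)
    · have : ((key j).2 : ℤ) < ((2 * (key j).1.natAbs : ℕ) : ℤ) := by
        rw [hk2]
        push_cast
        simp only [key]
        rw [abs_mul, abs_of_pos (show (0 : ℤ) < u by exact_mod_cast hu)]
        have := h5 j
        have hu' : (0 : ℤ) < u := by exact_mod_cast hu
        nlinarith
      exact_mod_cast this
    · rw [hk2]
      refine ⟨u * (g j).2.2, ?_⟩
      have := hdg j
      simp only [formDisc] at this
      simp only [key]
      linear_combination (u : ℤ) ^ 2 * this - hnu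
  have hcard := Finset.card_eq_sum_card_fiberwise hmaps
  rw [Finset.card_range] at hcard
  refine hcard.le.trans (Finset.sum_le_sum fun k _ => ?_)
  rcases (Finset.filter (fun j => key j = k) (Finset.range J)).eq_empty_or_nonempty with he | he
  · rw [he]; simp
  set F := Finset.filter (fun j => key j = k) (Finset.range J) with hF
  set j0 := F.min' he with hj0
  have hj0m : j0 ∈ F := F.min'_mem he
  have hk0 : key j0 = k := (Finset.mem_filter.1 hj0m).2
  set W := (Finset.range (2 * n + 1)).filter (fun i => 2 ^ i * k.1.natAbs ≤ 2 * n) with hW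
  have hsub : F ⊆ W.image (fun i => j0 + i) ∪ W.image (fun i => J - 1 - i) := by
    intro j hj
    have hle : j0 ≤ j := F.min'_le j hj
    obtain ⟨hjJ, hkj⟩ := Finset.mem_filter.1 hj
    rw [Finset.mem_range] at hjJ
    have hkk : key j = key j0 := by rw [hkj, hk0]
    have hu0 : (u : ℤ) ≠ 0 := by exact_mod_cast hu.ne'
    have g1 : (g j).1 = (g j0).1 := mul_left_cancel₀ hu0 (congrArg Prod.fst hkk)
    have g2 : (g j).2.1 = (g j0).2.1 := by
      apply mul_left_cancel₀ hu0
      rw [← hk2 j, ← hk2 j0, hkk]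
    have g3 : (g j).2.2 = (g j0).2.2 := by
      have d1 := hdg j
      have d2 := hdg j0
      simp only [formDisc] at d1 d2
      rw [g1, g2] at d1
      apply mul_left_cancel₀ (h3 j0)
      linarith
    have hg : g j = g j0 := Prod.ext g1 (Prod.ext g2 g3)
    have h20 := h2 j0
    rw [← hg] at h20
    have hcmp := compare a b c d n u hn hd hu ha hpr hdisc hnu θ θ' hθ hθ' (g j) _ _ _ _ _ _ _ _
      (h1 j) (h1 j0) (h2 j) h20
    have e6 := h6 j
    have e60 := h6 j0
    have e7 := h7 j
    have e70 := h7 j0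
    have e8 := h8 j0
    push_cast at e6 e60 e7 e70
    have hPj : (0 : ℝ) < 2 ^ j := by positivity
    have hPj0 : (0 : ℝ) < 2 ^ j0 := by positivity
    rw [Finset.mem_union]
    rcases hcmp with hc | hc
    · left
      refine Finset.mem_image.2 ⟨j - j0, ?_, by omega⟩
      rw [hW, ← hk0]
      apply conv
      have hpow : (2 : ℝ) ^ j = 2 ^ (j - j0) * 2 ^ j0 := by rw [← pow_add]; congr 1; omega
      have : ((2 : ℝ) ^ (j - j0) * |((g j0).1 : ℝ)|) * (a.natAbs * 2 ^ j0) ≤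
          (2 * Real.sqrt d) * (a.natAbs * 2 ^ j0) := by
        calc ((2 : ℝ) ^ (j - j0) * |((g j0).1 : ℝ)|) * (a.natAbs * 2 ^ j0)
            = |(p j0 : ℝ) - θ * r j0| * (a.natAbs * 2 ^ j) *
              (|(a : ℝ)| * |(p j0 : ℝ) - θ' * r j0|) := by rw [e8, hpow]; ring
          _ ≤ |(p j : ℝ) - θ * r j| * (a.natAbs * 2 ^ j) *
              (|(a : ℝ)| * |(p j0 : ℝ) - θ' * r j0|) := by gcongr
          _ ≤ 1 * (2 * Real.sqrt d * (a.natAbs * 2 ^ j0)) := by gcongr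
          _ = _ := by ring
      exact le_of_mul_le_mul_right this (by positivity)
    · right
      refine Finset.mem_image.2 ⟨J - 1 - j, ?_, by omega⟩
      rw [hW, ← hk0]
      apply conv
      have hpow : (2 : ℝ) ^ J = 2 * (2 ^ (J - 1 - j) * 2 ^ j) := by
        rw [← pow_add, ← pow_succ']; congr 1; omega
      have he2 : (2 : ℝ) ^ (J - 1 - j) * 2 ^ j ≤ eps d := by linarith
      have hone : (1 : ℝ) ≤ 2 ^ j0 := one_le_pow₀ (by norm_num)
      have : ((2 : ℝ) ^ (J - 1 - j) * |((g j0).1 : ℝ)|) * (a.natAbs * 2 ^ j) ≤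
          (2 * Real.sqrt d) * (a.natAbs * 2 ^ j) := by
        calc ((2 : ℝ) ^ (J - 1 - j) * |((g j0).1 : ℝ)|) * (a.natAbs * 2 ^ j)
            = (|(p j0 : ℝ) - θ * r j0| * (a.natAbs * 1)) * (|(a : ℝ)| *
              ((2 : ℝ) ^ (J - 1 - j) * 2 ^ j * |(p j0 : ℝ) - θ' * r j0|)) := by rw [e8]; ring
          _ ≤ (|(p j0 : ℝ) - θ * r j0| * (a.natAbs * 2 ^ j0)) * (|(a : ℝ)| *
              (eps d * |(p j0 : ℝ) - θ' * r j0|)) := by gcongr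
          _ ≤ 1 * (|(a : ℝ)| * |(p j : ℝ) - θ' * r j|) := by gcongr
          _ ≤ 1 * (2 * Real.sqrt d * (a.natAbs * 2 ^ j)) := by gcongr
          _ = _ := by ring
      exact le_of_mul_le_mul_right this (by positivity)
  calc F.card ≤ _ := Finset.card_le_card hsub
    _ ≤ (W.image (fun i => j0 + i)).card + (W.image (fun i => J - 1 - i)).card :=
        Finset.card_union_le _ _
    _ ≤ W.card + W.card := add_le_add Finset.card_image_le Finset.card_image_le
    _ = 2 * wt (2 * n) k := by rw [wt, ← two_mul]

lemma rel_unique (f f' : ℤ × ℤ × ℤ) (d u d' u' n : ℕ) (hu : 0 < u) (hu' : 0 < u')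
    (hn : d * u ^ 2 = n) (hn' : d' * u' ^ 2 = n) (k : ℤ × ℕ) (hk : k.1 ≠ 0)
    (h : KeyRel f d u k) (h' : KeyRel f' d' u' k) :
    d = d' ∧ u = u' ∧ ∃ g, IsPrimitiveForm g ∧ formDisc g = d ∧ formEquiv f g ∧
      formEquiv f' g := by
  obtain ⟨⟨a, b, c⟩, hp, hd, he, k1, k2⟩ := h
  obtain ⟨⟨a', b', c'⟩, hp', hd', he', k1', k2'⟩ := h'
  simp only [formDisc, IsPrimitiveForm] at *
  have i1 : (u : ℤ) * a = u' * a' := by rw [← k1, ← k1']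
  have i2 : (u : ℤ) * b = u' * b' := by rw [← k2, ← k2']
  have hnn : (d : ℤ) * u ^ 2 = d' * u' ^ 2 := by exact_mod_cast hn.trans hn'.symm
  have i3 : (u : ℤ) * c = u' * c' := by
    have h4 : (4 * k.1) ≠ 0 := by omega
    apply mul_left_cancel₀ h4
    have e1 : 4 * k.1 * (u * c) = (k.2 : ℤ) ^ 2 - d * u ^ 2 := by
      rw [k1, k2]; linear_combination (-(u : ℤ) ^ 2) * hd
    have e2 : 4 * k.1 * (u' * c') = (k.2 : ℤ) ^ 2 - d' * u' ^ 2 := by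
      rw [k1', k2']; linear_combination (-(u' : ℤ) ^ 2) * hd'
    rw [e1, e2, hnn]
  have cont : ∀ (v : ℕ) (x y z : ℤ), Int.gcd x (Int.gcd y z) = 1 →
      Int.gcd (v * x) (Int.gcd (v * y) (v * z)) = v := by
    intro v x y z h
    rw [Int.gcd_mul_left v y z, Int.natAbs_natCast]
    push_cast
    rw [Int.gcd_mul_left, h]; simp
  have huu : u = u' := by
    rw [← cont u a b c hp, i1, i2, i3, cont u' a' b' c' hp']
  subst huu
  have hu0 : (u : ℤ) ≠ 0 := by exact_mod_cast hu.ne'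
  have a1 := mul_left_cancel₀ hu0 i1
  have a2 := mul_left_cancel₀ hu0 i2
  have a3 := mul_left_cancel₀ hu0 i3
  subst a1 a2 a3
  refine ⟨?_, rfl, (a, b, c), hp, hd, he, he'⟩
  have : (d : ℤ) = d' := by rw [← hd, ← hd']
  exact_mod_cast this

lemma exists_finset_card (α : Type) : ∃ s : Finset α, s.card = Nat.card α := by
  rcases finite_or_infinite α with h | h
  · have := Fintype.ofFinite α
    exact ⟨Finset.univ, by rw [Nat.card_eq_fintype_card]; rfl⟩
  · exact ⟨∅, by simp⟩

/-- The type of classes counted by `classNumber`. -/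
abbrev Cls (d : ℤ) : Type :=
  Quot (fun f g : {f : ℤ × ℤ × ℤ // IsPrimitiveForm f ∧ formDisc f = d} => formEquiv f.1 g.1)

lemma exists_J (e : ℝ) (he : 1 < e) : ∃ J : ℕ, e ≤ 2 ^ J ∧ (2 : ℝ) ^ J < 2 * e := by
  classical
  have hex : ∃ J : ℕ, e ≤ 2 ^ J := by
    obtain ⟨J, hJ⟩ := pow_unbounded_of_one_lt e (one_lt_two)
    exact ⟨J, hJ.le⟩
  refine ⟨Nat.find hex, Nat.find_spec hex, ?_⟩
  have hpos : Nat.find hex ≠ 0 := by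
    intro h
    have := Nat.find_spec hex
    rw [h] at this; simp at this; linarith
  obtain ⟨m, hm⟩ := Nat.exists_eq_succ_of_ne_zero hpos
  have := Nat.find_min hex (m := m) (by omega)
  rw [hm, Nat.succ_eq_add_one, pow_succ]
  push Not at this
  linarith

lemma total_count (n : ℕ) (hn : 2 < n) (T : Finset (ℕ × ℕ))
    (hT : ∀ p ∈ T, 0 < p.1 ∧ 0 < p.2 ∧ p.1 * p.2 ^ 2 = n ^ 2 - 4) (J : ℕ × ℕ → ℕ)
    (hJ : ∀ p ∈ T, (2 : ℝ) ^ J p < 2 * eps (p.1 : ℤ)) :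
    ∑ p ∈ T, classNumber (p.1 : ℤ) * J p ≤
      2 * ∑ k ∈ keys ((n : ℤ) ^ 2 - 4) (2 * n), wt (2 * n) k := by
  classical
  have h4 : 4 ≤ n ^ 2 := by nlinarith
  choose S hS using fun p : ℕ × ℕ => exists_finset_card (Cls (p.1 : ℤ))
  have e1 : ∑ p ∈ T, classNumber (p.1 : ℤ) * J p = ∑ x ∈ T.sigma S, J x.1 := by
    rw [Finset.sum_sigma]
    refine Finset.sum_congr rfl fun p _ => ?_
    change _ = ∑ _s ∈ S p, J p
    rw [Finset.sum_const, smul_eq_mul, hS p]; rfl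
  rw [e1]
  let K : (Σ p : ℕ × ℕ, Cls (p.1 : ℤ)) → Finset (ℤ × ℕ) := fun x =>
    (keys ((n : ℤ) ^ 2 - 4) (2 * n)).filter (KeyRel x.2.out.1 x.1.1 x.1.2)
  have e2 : ∀ x ∈ T.sigma S, J x.1 ≤ ∑ k ∈ K x, 2 * wt (2 * n) k := by
    rintro ⟨p, c⟩ hx
    have hp : p ∈ T := (Finset.mem_sigma.1 hx).1
    obtain ⟨h1, h2, h3⟩ := hT p hp
    have hnu : (n : ℤ) ^ 2 - (p.1 : ℤ) * (p.2 : ℤ) ^ 2 = 4 := by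
      have : p.1 * p.2 ^ 2 + 4 = n ^ 2 := by omega
      have : (p.1 : ℤ) * (p.2 : ℤ) ^ 2 + 4 = (n : ℤ) ^ 2 := by exact_mod_cast this
      linarith
    exact class_bound c.out.1.1 c.out.1.2.1 c.out.1.2.2 p.1 n p.2 hn h1 h2 c.out.2.1 c.out.2.2
      hnu (J p) (hJ p hp)
  refine (Finset.sum_le_sum e2).trans ?_
  rw [← Finset.sum_biUnion, Finset.mul_sum]
  · refine Finset.sum_le_sum_of_subset ?_
    intro k hk
    obtain ⟨x, _, hx⟩ := Finset.mem_biUnion.1 hk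
    exact (Finset.mem_filter.1 hx).1
  · rintro ⟨p, c⟩ hx ⟨p', c'⟩ hx' hne
    rw [Function.onFun, Finset.disjoint_left]
    intro k hk hk'
    apply hne
    obtain ⟨hk1, hk2⟩ := Finset.mem_filter.1 hk
    obtain ⟨-, hk2'⟩ := Finset.mem_filter.1 hk'
    obtain ⟨-, h2, h3⟩ := hT p (Finset.mem_sigma.1 hx).1
    obtain ⟨-, h2', h3'⟩ := hT p' (Finset.mem_sigma.1 hx').1
    have hk0 := ((mem_keys _ _ _).1 hk1).2.1
    obtain ⟨q1, q2, g, hg1, hg2, hg3, hg4⟩ :=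
      rel_unique _ _ _ _ _ _ _ h2 h2' h3 h3' k hk0 hk2 hk2'
    have hpp : p = p' := Prod.ext q1 q2
    subst hpp
    have hcc : c = c' := by
      rw [← Quot.out_eq c, ← Quot.out_eq c']
      have a1 := Quot.sound (r := fun f g : {f : ℤ × ℤ × ℤ // IsPrimitiveForm f ∧
        formDisc f = (p.1 : ℤ)} => formEquiv f.1 g.1) (a := c.out) (b := ⟨g, hg1, hg2⟩) hg3
      have a2 := Quot.sound (r := fun f g : {f : ℤ × ℤ × ℤ // IsPrimitiveForm f ∧
        formDisc f = (p.1 : ℤ)} => formEquiv f.1 g.1) (a := c'.out) (b := ⟨g, hg1, hg2⟩) hg4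
      exact a1.trans a2.symm
    rw [hcc]

/-- **Upper bound for the amplitude**: `A(n) = O((log n)²)`, i.e. there is `C > 0` with
`A(n) ≤ C·(log n)²` for all integers `n > 2`. -/
theorem ampA_le_log_sq : ∃ C : ℝ, 0 < C ∧ ∀ n : ℕ, 2 < n →
    ampA n ≤ C * Real.log n ^ 2 := by
  refine ⟨288, by norm_num, fun n hn => ?_⟩
  have hnr : (3 : ℝ) ≤ n := by exact_mod_cast hn
  have h4 : 4 ≤ n ^ 2 := by nlinarith
  set T := (Finset.range (n ^ 2) ×ˢ Finset.range (n ^ 2)).filter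
      (fun p => 0 < p.1 ∧ 0 < p.2 ∧ (p.1 % 4 = 0 ∨ p.1 % 4 = 1) ∧ p.1 * p.2 ^ 2 = n ^ 2 - 4)
    with hTdef
  have hT : ∀ p ∈ T, 0 < p.1 ∧ 0 < p.2 ∧ p.1 * p.2 ^ 2 = n ^ 2 - 4 := by
    intro p hp
    obtain ⟨h1, h2, -, h3⟩ := (Finset.mem_filter.1 hp).2
    exact ⟨h1, h2, h3⟩
  have heps : ∀ p ∈ T, 1 < eps (p.1 : ℤ) := by
    intro p hp
    obtain ⟨h1, h2, h3⟩ := hT p hp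
    refine (eps_spec p.1 n p.2 hn h1 h2 ?_).1
    have : p.1 * p.2 ^ 2 + 4 = n ^ 2 := by omega
    have : (p.1 : ℤ) * (p.2 : ℤ) ^ 2 + 4 = (n : ℤ) ^ 2 := by exact_mod_cast this
    linarith
  have hJex : ∀ p : ℕ × ℕ, ∃ J : ℕ, p ∈ T →
      eps (p.1 : ℤ) ≤ 2 ^ J ∧ (2 : ℝ) ^ J < 2 * eps (p.1 : ℤ) := by
    intro p
    by_cases hp : p ∈ T
    · obtain ⟨J, hJ⟩ := exists_J _ (heps p hp)
      exact ⟨J, fun _ => hJ⟩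
    · exact ⟨0, fun h => absurd h hp⟩
  choose J hJ using hJex
  have hcount := total_count n hn T hT J (fun p hp => (hJ p hp).2)
  have hwt := sum_wt_le ((n : ℤ) ^ 2 - 4) (2 * n) (by omega)
  have hlog1 : 1 ≤ Real.log n := by
    rw [Real.le_log_iff_exp_le (by linarith)]
    linarith [Real.exp_one_lt_d9]
  have hlog2 : 1 + Real.log ((2 * n : ℕ) : ℝ) ≤ 3 * Real.log n := by
    push_cast
    rw [Real.log_mul (by norm_num) (by linarith)]
    linarith [Real.log_two_lt_d9]
  have hlog3 : 0 ≤ Real.log ((2 * n : ℕ) : ℝ) := Real.log_natCast_nonneg _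
  have hterm : ∀ p ∈ T, (classNumber (p.1 : ℤ) : ℝ) * Real.log (eps (p.1 : ℤ)) /
      ((p.2 : ℝ) * Real.sqrt (p.1 : ℝ)) ≤ ((classNumber (p.1 : ℤ) * J p : ℕ) : ℝ) / (n / 2) := by
    intro p hp
    obtain ⟨h1, h2, h3⟩ := hT p hp
    have hden : (n : ℝ) / 2 ≤ (p.2 : ℝ) * Real.sqrt (p.1 : ℝ) := by
      refine le_of_sq_le_sq ?_ (by positivity)
      rw [mul_pow, Real.sq_sqrt (by positivity)]
      have : p.1 * p.2 ^ 2 + 4 = n ^ 2 := by omega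
      have : (p.1 : ℝ) * (p.2 : ℝ) ^ 2 + 4 = (n : ℝ) ^ 2 := by exact_mod_cast this
      nlinarith
    have hlogJ : Real.log (eps (p.1 : ℤ)) ≤ J p := by
      have e0 : 0 < eps (p.1 : ℤ) := by linarith [heps p hp]
      calc Real.log (eps (p.1 : ℤ)) ≤ Real.log (2 ^ J p) := Real.log_le_log e0 (hJ p hp).1
        _ = J p * Real.log 2 := by rw [Real.log_pow]
        _ ≤ J p * 1 := by gcongr; linarith [Real.log_two_lt_d9]
        _ = J p := mul_one _
    push_cast
    gcongr
  have hn2 : (0 : ℝ) < (n : ℝ) / 2 := by linarith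
  calc ampA n ≤ ∑ p ∈ T, ((classNumber (p.1 : ℤ) * J p : ℕ) : ℝ) / (n / 2) :=
        Finset.sum_le_sum hterm
    _ = ((∑ p ∈ T, classNumber (p.1 : ℤ) * J p : ℕ) : ℝ) / (n / 2) := by
        rw [← Finset.sum_div]; push_cast; rfl
    _ ≤ (2 * (4 * (((2 * n : ℕ) : ℝ) * (1 + Real.log ((2 * n : ℕ) : ℝ)) ^ 2))) / (n / 2) := by
        gcongr
        calc ((∑ p ∈ T, classNumber (p.1 : ℤ) * J p : ℕ) : ℝ)
            ≤ ((2 * ∑ k ∈ keys ((n : ℤ) ^ 2 - 4) (2 * n), wt (2 * n) k : ℕ) : ℝ) := by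
              exact_mod_cast hcount
          _ ≤ _ := by
              rw [Nat.cast_mul, Nat.cast_ofNat]
              gcongr
    _ ≤ (2 * (4 * (((2 * n : ℕ) : ℝ) * (3 * Real.log n) ^ 2))) / (n / 2) := by gcongr
    _ = 288 * Real.log n ^ 2 := by
        push_cast
        field_simp
        ring
end

section
/- For every integer K ≥ 1 there is a constant c_K > 0 with the following property: for all integers n_1, …, n_K > 2 and all choices of signs sign_j ∈ {+1, −1}, if Σ_{j=1}^K sign_j·log N(n_j) ≠ 0, then |Σ_{j=1}^K sign_j·log N(n_j)| ≥ c_K · (∏_{j=1}^K N(n_j))^{−(2^{K−1} − 1/2)}. -/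
/-- `N(n) = ((n + √(n²−4))/2)²`, the norm of a hyperbolic class of trace `n`. -/
noncomputable def Nnorm (n : ℕ) : ℝ := (((n : ℝ) + Real.sqrt ((n : ℝ) ^ 2 - 4)) / 2) ^ 2

lemma one_le_prod_real {K : ℕ} (e : Fin K → ℝ) (h1 : ∀ j, 1 ≤ e j) : 1 ≤ ∏ j, e j := by
  calc (1 : ℝ) = ∏ _j : Fin K, (1 : ℝ) := by simp
    _ ≤ _ := Finset.prod_le_prod (fun _ _ => zero_le_one) (fun j _ => h1 j)

open Polynomial in
lemma reduce_aux (n : ℤ) (A : ℤ[X]) : ∃ B C : ℤ[X], ∀ e : ℝ, e ^ 2 = n * e - 1 →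
    ∀ u : ℝ, aeval (u * e) A = aeval u B + e * aeval u C := by
  have hp : ∀ k : ℕ, ∃ b c : ℤ, ∀ e : ℝ, e ^ 2 = n * e - 1 → e ^ k = b + e * c := by
    intro k
    induction k with
    | zero => exact ⟨1, 0, fun e _ => by simp⟩
    | succ k ih =>
      obtain ⟨b, c, h⟩ := ih
      refine ⟨-c, b + n * c, fun e he => ?_⟩
      rw [pow_succ, h e he]
      push_cast
      linear_combination (c : ℝ) * he
  induction A using Polynomial.induction_on' with
  | add p q hp hq =>
    obtain ⟨B, C, h⟩ := hp
    obtain ⟨B', C', h'⟩ := hq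
    refine ⟨B + B', C + C', fun e he u => ?_⟩
    rw [map_add, map_add, map_add, h e he, h' e he]
    ring
  | monomial k a =>
    obtain ⟨b, c, h⟩ := hp k
    refine ⟨monomial k (a * b), monomial k (a * c), fun e he u => ?_⟩
    simp only [aeval_monomial, mul_pow, h e he]
    simp
    ring

open Polynomial in
lemma exists_multiset (K : ℕ) : ∀ (n : Fin K → ℤ) (e a : Fin K → ℝ), (∀ j, 1 ≤ e j) →
    (∀ j, e j ^ 2 = n j * e j - 1) → (∀ j, a j = e j ∨ a j = (e j)⁻¹) →
    ∃ (M : Multiset ℝ) (G : ℤ[X]), M.card = 2 ^ K ∧ (∀ y ∈ M, 0 < y ∧ y ≤ ∏ j, e j) ∧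
      ∏ j, a j ∈ M ∧ ∀ u : ℝ, aeval u G = (M.map (fun y => 1 - u * y)).prod := by
  induction K with
  | zero =>
    intro n e a _ _ _
    exact ⟨{1}, 1 - X, by simp, by simp, by simp, by simp⟩
  | succ K ih =>
    intro n e a h1 h2 h3
    obtain ⟨M, G, hc, hb, hm, hG⟩ := ih (fun j => n j.succ) (fun j => e j.succ)
      (fun j => a j.succ) (fun j => h1 _) (fun j => h2 _) (fun j => h3 _)
    obtain ⟨B, C, hBC⟩ := reduce_aux (n 0) G
    have he : 1 ≤ e 0 := h1 0
    have he0 : e 0 ≠ 0 := by positivity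
    have hi : (e 0)⁻¹ ≤ 1 := inv_le_one_of_one_le₀ he
    have hq := h2 0
    have hq' : ((e 0)⁻¹) ^ 2 = n 0 * (e 0)⁻¹ - 1 := by
      field_simp
      linear_combination hq
    have hsum : e 0 + (e 0)⁻¹ = n 0 := by
      field_simp
      linear_combination hq
    refine ⟨M.map (fun y => e 0 * y) + M.map (fun y => (e 0)⁻¹ * y),
      B ^ 2 + Polynomial.C (n 0) * B * C + C ^ 2, ?_, ?_, ?_, ?_⟩
    · simp [hc, pow_succ]; ring
    · intro y hy
      rw [Fin.prod_univ_succ]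
      rw [Multiset.mem_add, Multiset.mem_map, Multiset.mem_map] at hy
      rcases hy with ⟨z, hz, rfl⟩ | ⟨z, hz, rfl⟩
      · obtain ⟨p, q⟩ := hb z hz
        exact ⟨by positivity, by gcongr⟩
      · obtain ⟨p, q⟩ := hb z hz
        exact ⟨by positivity, mul_le_mul (hi.trans he) q p.le (by positivity)⟩
    · rw [Fin.prod_univ_succ, Multiset.mem_add, Multiset.mem_map, Multiset.mem_map]
      rcases h3 0 with h | h
      · exact Or.inl ⟨_, hm, by rw [h]⟩
      · exact Or.inr ⟨_, hm, by rw [h]⟩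
    · intro u
      have e1 := hBC _ hq u
      have e2 := hBC _ hq' u
      rw [hG] at e1 e2
      rw [Multiset.map_add, Multiset.prod_add, Multiset.map_map, Multiset.map_map]
      simp only [Function.comp_def, ← mul_assoc]
      rw [e1, e2]
      simp only [map_add, map_mul, map_pow, aeval_C]
      simp only [algebraMap_int_eq, eq_intCast]
      rw [← hsum]
      field_simp
      ring

open Polynomial in
lemma one_le_prod (M : Multiset ℝ) (G : ℤ[X])
    (hG : ∀ u : ℝ, aeval u G = (M.map (fun y => 1 - u * y)).prod) :
    1 ≤ (M.map (fun y : ℝ => if y = 1 then 1 else |1 - y|)).prod := by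
  have key : ∀ M : Multiset ℝ,
      |((M.map (fun y : ℝ => Polynomial.C (1 - y) - Polynomial.C y * X)).prod).trailingCoeff| =
      (M.map (fun y : ℝ => if y = 1 then 1 else |1 - y|)).prod := by
    intro M
    induction M using Multiset.induction_on with
    | empty => simp [trailingCoeff]
    | cons y M ih =>
      rw [Multiset.map_cons, Multiset.prod_cons, trailingCoeff_mul, abs_mul, ih, Multiset.map_cons,
        Multiset.prod_cons]
      congr 1
      split_ifs with h
      · subst h
        have : (Polynomial.C (1 - 1 : ℝ) - Polynomial.C 1 * X) = Polynomial.monomial 1 (-1) := by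
          simp [← C_mul_X_eq_monomial]
        rw [this]
        simp [trailingCoeff, natTrailingDegree_monomial]
      · have hy : 1 - y ≠ 0 := fun h' => h (by linarith)
        have h0 : (Polynomial.C (1 - y) - Polynomial.C y * X).coeff 0 = 1 - y := by
          simp
        have : (Polynomial.C (1 - y) - Polynomial.C y * X).natTrailingDegree = 0 :=
          natTrailingDegree_eq_zero.2 (Or.inr (by rw [h0]; exact hy))
        rw [trailingCoeff, this, h0]
  have hmap : (G.comp (X + 1)).map (Int.castRingHom ℝ) =
      (M.map (fun y : ℝ => Polynomial.C (1 - y) - Polynomial.C y * X)).prod := by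
    apply Polynomial.funext
    intro u
    have := hG (u + 1)
    rw [eval_multiset_prod, Multiset.map_map, Polynomial.map_comp, eval_comp]
    rw [aeval_def, algebraMap_int_eq, ← eval_map] at this
    simp only [Polynomial.map_add, map_X, Polynomial.map_one, eval_add, eval_X, eval_one]
    rw [this]
    congr 1
    apply Multiset.map_congr rfl
    intro y _
    simp
    ring
  have hpos : 0 < (M.map (fun y : ℝ => if y = 1 then 1 else |1 - y|)).prod := by
    apply Multiset.prod_pos
    intro z hz
    obtain ⟨y, _, rfl⟩ := Multiset.mem_map.1 hz
    split_ifs with h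
    · norm_num
    · exact abs_pos.2 (fun h' => h (by linarith))
  rw [← key M, ← hmap] at hpos ⊢
  rw [trailingCoeff, coeff_map, eq_intCast, ← Int.cast_abs] at hpos ⊢
  exact_mod_cast hpos

lemma liouville_main (K : ℕ) (n : Fin K → ℤ) (e a : Fin K → ℝ) (h1 : ∀ j, 1 ≤ e j)
    (h2 : ∀ j, e j ^ 2 = n j * e j - 1) (h3 : ∀ j, a j = e j ∨ a j = (e j)⁻¹)
    (hne : ∏ j, a j ≠ 1) : 1 ≤ |1 - ∏ j, a j| * (∏ j, e j) ^ (2 ^ K - 1) := by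
  obtain ⟨M, G, hc, hb, hm, hG⟩ := exists_multiset K n e a h1 h2 h3
  have h := one_le_prod M G hG
  obtain ⟨M', rfl⟩ := Multiset.exists_cons_of_mem hm
  rw [Multiset.map_cons, Multiset.prod_cons, if_neg hne] at h
  refine h.trans ?_
  gcongr
  have hc' : (M'.map (fun y : ℝ => if y = 1 then 1 else |1 - y|)).card = 2 ^ K - 1 := by
    rw [Multiset.card_map, ← hc, Multiset.card_cons]; rfl
  have hB : 1 ≤ ∏ j, e j := one_le_prod_real e h1
  have hle : ∀ y ∈ M', (if y = 1 then 1 else |1 - y|) ≤ ∏ j, e j := by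
    intro y hy
    obtain ⟨p, q⟩ := hb y (Multiset.mem_cons_of_mem hy)
    split_ifs
    · exact hB
    · rw [abs_le]; constructor <;> linarith
  rw [← hc']
  calc _ ≤ (M'.map (fun _ : ℝ => ∏ j, e j)).prod := by
        apply Multiset.prod_map_le_prod_map₀
        · intro y _
          split_ifs <;> positivity
        · exact hle
    _ = _ := by simp

/-- **Lemma 3(ii) (`use Liouville`)**: for every `K ≥ 1` there is `c_K > 0` such that
whenever `n_1, …, n_K > 2` and `sign_j = ±1` with `Σ_j sign_j·log N(n_j) ≠ 0`, one has
`|Σ_j sign_j·log N(n_j)| ≥ c_K·(∏_j N(n_j))^{−(2^{K−1} − 1/2)}`. -/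
theorem liouville_lower_bound (K : ℕ) (hK : 1 ≤ K) : ∃ c : ℝ, 0 < c ∧
    ∀ n : Fin K → ℕ, (∀ j, 2 < n j) →
    ∀ sign : Fin K → ℝ, (∀ j, sign j = 1 ∨ sign j = -1) →
    ∑ j, sign j * Real.log (Nnorm (n j)) ≠ 0 →
    c * (∏ j, Nnorm (n j)) ^ (-((2 : ℝ) ^ (K - 1) - 1 / 2)) ≤
      |∑ j, sign j * Real.log (Nnorm (n j))| := by
  refine ⟨1, one_pos, fun n hn s hs hne => ?_⟩
  set e : Fin K → ℝ := fun j => ((n j : ℝ) + Real.sqrt ((n j : ℝ) ^ 2 - 4)) / 2 with he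
  have hN : ∀ j, Nnorm (n j) = e j ^ 2 := fun j => rfl
  have hn' : ∀ j, (2 : ℝ) < n j := fun j => by exact_mod_cast hn j
  have h1 : ∀ j, 1 ≤ e j := fun j => by
    have := Real.sqrt_nonneg ((n j : ℝ) ^ 2 - 4)
    have := hn' j
    simp only [he]; linarith
  have h2 : ∀ j, e j ^ 2 = ((n j : ℤ) : ℝ) * e j - 1 := fun j => by
    have hq := Real.sq_sqrt (show 0 ≤ (n j : ℝ) ^ 2 - 4 by nlinarith [hn' j])
    simp only [he, Int.cast_natCast]
    linear_combination hq / 4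
  have hpos : ∀ j, 0 < e j := fun j => by linarith [h1 j]
  set L := ∑ j, s j * Real.log (e j) with hL
  have hsum : ∑ j, s j * Real.log (Nnorm (n j)) = 2 * L := by
    rw [hL, Finset.mul_sum]
    refine Finset.sum_congr rfl fun j _ => ?_
    rw [hN, Real.log_pow]; push_cast; ring
  rw [hsum] at hne ⊢
  have hL0 : L ≠ 0 := fun h => hne (by rw [h, mul_zero])
  have hexp : ∏ j, Real.exp (s j * Real.log (e j)) = Real.exp L := by
    rw [hL, Real.exp_sum]
  have hm := liouville_main K (fun j => (n j : ℤ)) e (fun j => Real.exp (s j * Real.log (e j)))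
    h1 h2 (fun j => by
      rcases hs j with h | h
      · left; simp [h, Real.exp_log (hpos j)]
      · right; simp [h, Real.exp_neg, Real.exp_log (hpos j)])
    (by rw [hexp]; simpa using hL0)
  rw [hexp] at hm
  have hB : 1 ≤ ∏ j, e j := one_le_prod_real e h1
  set B := ∏ j, e j with hBdef
  have hB0 : 0 < B := by linarith
  have hP : (∏ j, Nnorm (n j)) ^ (-((2 : ℝ) ^ (K - 1) - 1 / 2)) = (B ^ (2 ^ K - 1))⁻¹ := by
    simp only [hN]
    rw [Finset.prod_pow, ← hBdef, ← Real.rpow_natCast B 2, ← Real.rpow_mul hB0.le,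
      ← Real.rpow_natCast B, ← Real.rpow_neg hB0.le]
    congr 1
    obtain ⟨k, rfl⟩ : ∃ k, K = k + 1 := ⟨K - 1, by omega⟩
    rw [Nat.cast_sub Nat.one_le_two_pow]
    push_cast
    ring
  rw [hP, one_mul]
  have hBp : 0 < B ^ (2 ^ K - 1) := by positivity
  rw [abs_mul, abs_two]
  by_cases hl : |L| ≤ 1
  · have h3 := Real.abs_exp_sub_one_le hl
    rw [abs_sub_comm] at h3
    refine le_trans ?_ h3
    rw [inv_le_iff_one_le_mul₀ hBp]
    exact hm
  · have : (B ^ (2 ^ K - 1))⁻¹ ≤ 1 := inv_le_one_of_one_le₀ (one_le_pow₀ hB)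
    push Not at hl
    linarith
end

section
/- For every integer n > 2, the conjugacy-class sum (1/2)·Σ_{[P] : |tr P| = n} log N(P_0) / (N(P)^{1/2} − N(P)^{−1/2}), taken over all conjugacy classes [P] of hyperbolic elements P of PSL(2,ℤ) with |tr P| = n, where P = P_0^k with P_0 primitive and N(·) denotes the norm, equals A(n) = Σ h(d)·log(ε_d)/(u·√d), summed over all pairs (d,u) of positive integers with d a discriminant and d·u² = n² − 4. -/
open scoped MatrixGroups

/-- An element `γ` of `PSL(2,ℤ)` has `|trace| = m` (the absolute value of the trace is
well defined on `PSL(2,ℤ)`): some lift `A ∈ SL(2,ℤ)` of `γ` has `|tr A| = m`. -/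
def PSLTraceAbs (γ : PSL(2, ℤ)) (m : ℕ) : Prop :=
  ∃ A : Matrix.SpecialLinearGroup (Fin 2) ℤ,
    (QuotientGroup.mk A : PSL(2, ℤ)) = γ ∧
      (Matrix.trace (A : Matrix (Fin 2) (Fin 2) ℤ)).natAbs = m

/-- An element of `PSL(2,ℤ)` is primitive if it is not a proper power: `γ = δ^k` with
`k ≥ 1` forces `k = 1`. -/
def PSLPrimitive (γ : PSL(2, ℤ)) : Prop :=
  ∀ (δ : PSL(2, ℤ)) (k : ℕ), 1 ≤ k → γ = δ ^ k → k = 1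

abbrev SLZ := Matrix.SpecialLinearGroup (Fin 2) ℤ

def formOf (A : SLZ) : ℤ × ℤ × ℤ := (A.1 1 0, A.1 1 1 - A.1 0 0, - A.1 0 1)

lemma SLZ_det (A : SLZ) : A.1 0 0 * A.1 1 1 - A.1 0 1 * A.1 1 0 = 1 := by
  have := A.2
  rwa [Matrix.det_fin_two] at this

lemma SLZ_tr (A : SLZ) : Matrix.trace A.1 = A.1 0 0 + A.1 1 1 := Matrix.trace_fin_two _

lemma SLZ_ext {A B : SLZ} (hf : formOf A = formOf B) (ht : Matrix.trace A.1 = Matrix.trace B.1) :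
    A = B := by
  rw [SLZ_tr, SLZ_tr] at ht
  simp only [formOf, Prod.mk.injEq] at hf
  obtain ⟨h1, h2, h3⟩ := hf
  apply Subtype.ext
  ext i j
  fin_cases i <;> fin_cases j <;> simp <;> linarith

lemma SLZ_mul (A B : SLZ) (i j : Fin 2) :
    (A * B).1 i j = A.1 i 0 * B.1 0 j + A.1 i 1 * B.1 1 j := by
  change (A.1 * B.1) i j = _
  rw [Matrix.mul_apply, Fin.sum_univ_two]

lemma SLZ_inv00 (A : SLZ) : (A⁻¹).1 0 0 = A.1 1 1 := by
  simp [Matrix.SpecialLinearGroup.SL2_inv_expl]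
lemma SLZ_inv01 (A : SLZ) : (A⁻¹).1 0 1 = - A.1 0 1 := by
  simp [Matrix.SpecialLinearGroup.SL2_inv_expl]
lemma SLZ_inv10 (A : SLZ) : (A⁻¹).1 1 0 = - A.1 1 0 := by
  simp [Matrix.SpecialLinearGroup.SL2_inv_expl]
lemma SLZ_inv11 (A : SLZ) : (A⁻¹).1 1 1 = A.1 0 0 := by
  simp [Matrix.SpecialLinearGroup.SL2_inv_expl]

lemma form_ext {f g : ℤ × ℤ × ℤ} (h : ∀ x y, formVal f x y = formVal g x y) : f = g := by
  have h1 := h 1 0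
  have h2 := h 0 1
  have h3 := h 1 1
  simp only [formVal] at h1 h2 h3
  obtain ⟨a, b, c⟩ := f
  obtain ⟨a', b', c'⟩ := g
  simp only [Prod.mk.injEq] at *
  refine ⟨?_, ?_, ?_⟩ <;> linarith

lemma formVal_conj (A M : SLZ) (x y : ℤ) :
    formVal (formOf (M⁻¹ * A * M)) x y =
      formVal (formOf A) (M.1 0 0 * x + M.1 0 1 * y) (M.1 1 0 * x + M.1 1 1 * y) := by
  simp only [formVal, formOf, SLZ_mul, SLZ_inv00, SLZ_inv01, SLZ_inv10, SLZ_inv11]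
  ring

lemma trace_conj (A M : SLZ) : Matrix.trace (M⁻¹ * A * M).1 = Matrix.trace A.1 := by
  have := SLZ_det M
  simp only [SLZ_tr, SLZ_mul, SLZ_inv00, SLZ_inv01, SLZ_inv10, SLZ_inv11]
  linear_combination (A.1 0 0 + A.1 1 1) * this

lemma conj_of_form {A B M : SLZ} (ht : Matrix.trace A.1 = Matrix.trace B.1)
    (h : ∀ x y, formVal (formOf B) x y =
      formVal (formOf A) (M.1 0 0 * x + M.1 0 1 * y) (M.1 1 0 * x + M.1 1 1 * y)) :
    M⁻¹ * A * M = B := by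
  apply SLZ_ext
  · apply form_ext
    intro x y
    rw [formVal_conj, h]
  · rw [trace_conj, ht]

def smulForm (u : ℤ) (f : ℤ × ℤ × ℤ) : ℤ × ℤ × ℤ := (u * f.1, u * f.2.1, u * f.2.2)

lemma formVal_smul (u : ℤ) (f : ℤ × ℤ × ℤ) (x y : ℤ) :
    formVal (smulForm u f) x y = u * formVal f x y := by
  simp only [formVal, smulForm]; ring

lemma prim_bezout {f : ℤ × ℤ × ℤ} (h : IsPrimitiveForm f) :
    ∃ x y z : ℤ, x * f.1 + y * f.2.1 + z * f.2.2 = 1 := by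
  unfold IsPrimitiveForm at h
  have h1 := Int.gcd_eq_gcd_ab f.1 (Int.gcd f.2.1 f.2.2)
  rw [h] at h1
  have h2 := Int.gcd_eq_gcd_ab f.2.1 f.2.2
  refine ⟨f.1.gcdA (Int.gcd f.2.1 f.2.2), f.2.1.gcdA f.2.2 * f.1.gcdB (Int.gcd f.2.1 f.2.2),
    f.2.1.gcdB f.2.2 * f.1.gcdB (Int.gcd f.2.1 f.2.2), ?_⟩
  push_cast at h1
  linear_combination -h1 - f.1.gcdB (Int.gcd f.2.1 f.2.2) * h2

lemma dvd_of_prim {f : ℤ × ℤ × ℤ} (h : IsPrimitiveForm f) {k u : ℤ}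
    (hk : ∀ x y, k ∣ u * formVal f x y) : k ∣ u := by
  obtain ⟨x, y, z, e⟩ := prim_bezout h
  obtain ⟨r1, h1⟩ := hk 1 0
  obtain ⟨r2, h2⟩ := hk 0 1
  obtain ⟨r3, h3⟩ := hk 1 1
  simp only [formVal] at h1 h2 h3
  refine ⟨x * r1 + y * (r3 - r1 - r2) + z * r2, ?_⟩
  linear_combination (-u) * e + x * h1 + y * (h3 - h1 - h2) + z * h2

/-- existence of the matrix -/
lemma exists_mat (f : ℤ × ℤ × ℤ) (t u : ℤ) (h : t ^ 2 - formDisc f * u ^ 2 = 4) :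
    ∃ A : SLZ, formOf A = smulForm u f ∧ Matrix.trace A.1 = t := by
  obtain ⟨a, b, c⟩ := f
  simp only [formDisc] at h
  have hp : (2 : ℤ) ∣ t - b * u := by
    have : Even ((t - b * u) * (t + b * u)) := ⟨2 - 2 * a * c * u ^ 2, by linear_combination h⟩
    rcases Int.even_mul.1 this with h | h
    · exact h.two_dvd
    · have := h.two_dvd
      omega
  obtain ⟨s, hs⟩ := hp
  have hdet : Matrix.det !![s, -(u * c); u * a, s + u * b] = 1 := by
    rw [Matrix.det_fin_two_of]
    have ht : t = 2 * s + b * u := by linarith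
    subst ht
    have : 4 * (s * (s + u * b) - -(u * c) * (u * a)) = 4 * 1 := by linear_combination h
    linarith
  refine ⟨⟨!![s, -(u * c); u * a, s + u * b], hdet⟩, ?_, ?_⟩
  · simp [formOf, smulForm]
  · simp only [Matrix.trace_fin_two_of]; linarith

lemma disc_eq {A : SLZ} {f : ℤ × ℤ × ℤ} {u : ℤ} (h : formOf A = smulForm u f) :
    (Matrix.trace A.1) ^ 2 - formDisc f * u ^ 2 = 4 := by
  have hd := SLZ_det A
  rw [SLZ_tr]
  simp only [formOf, smulForm, Prod.mk.injEq] at h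
  obtain ⟨h1, h2, h3⟩ := h
  simp only [formDisc]
  have e : A.1 1 1 = A.1 0 0 + u * f.2.1 := by linarith
  have e' : A.1 0 1 = - (u * f.2.2) := by linarith
  rw [e, e', h1] at hd
  rw [e]
  linear_combination 4 * hd

lemma content {g : ℤ × ℤ × ℤ} (hg : formDisc g ≠ 0) :
    ∃ (u : ℕ) (f : ℤ × ℤ × ℤ), 0 < u ∧ IsPrimitiveForm f ∧ g = smulForm u f := by
  obtain ⟨a, b, c⟩ := g
  obtain ⟨u, hu⟩ : ∃ u, u = Int.gcd a (Int.gcd b c) := ⟨_, rfl⟩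
  have hu0 : 0 < u := by
    rw [Nat.pos_iff_ne_zero]
    intro h
    rw [hu, Int.gcd_eq_zero_iff] at h
    obtain ⟨rfl, h⟩ := h
    norm_cast at h
    rw [Int.gcd_eq_zero_iff] at h
    obtain ⟨rfl, rfl⟩ := h
    simp [formDisc] at hg
  have ha : (u : ℤ) ∣ a := hu ▸ Int.gcd_dvd_left _ _
  have hbc : (u : ℤ) ∣ Int.gcd b c := hu ▸ Int.gcd_dvd_right _ _
  have hb : (u : ℤ) ∣ b := hbc.trans (Int.gcd_dvd_left _ _)
  have hc : (u : ℤ) ∣ c := hbc.trans (Int.gcd_dvd_right _ _)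
  obtain ⟨a', rfl⟩ := ha
  obtain ⟨b', rfl⟩ := hb
  obtain ⟨c', rfl⟩ := hc
  refine ⟨u, (a', b', c'), hu0, ?_, rfl⟩
  unfold IsPrimitiveForm
  simp only
  have : u = u * Int.gcd a' (Int.gcd b' c') := by
    conv_lhs => rw [hu]
    rw [Int.gcd_mul_left, Int.natAbs_natCast]
    push_cast
    rw [Int.gcd_mul_left, Int.natAbs_natCast]
  exact Nat.eq_of_mul_eq_mul_left hu0 (by rw [← this, mul_one])

open scoped MatrixGroups

lemma PSL_mk_eq {A B : SLZ} (h : (QuotientGroup.mk A : PSL(2, ℤ)) = QuotientGroup.mk B) :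
    A = B ∨ A = -B := by
  rw [QuotientGroup.eq, Matrix.SpecialLinearGroup.mem_center_iff] at h
  obtain ⟨r, hr, h⟩ := h
  have hr' : r = 1 ∨ r = -1 := by
    simp at hr
    exact hr
  rcases hr' with rfl | rfl
  · left
    have : A⁻¹ * B = 1 := by
      apply Subtype.ext
      rw [← h]
      simp
    exact (inv_mul_eq_one.1 this)
  · right
    have : A⁻¹ * B = -1 := by
      apply Subtype.ext
      rw [← h]
      ext i j
      fin_cases i <;> fin_cases j <;> simp
    have := inv_mul_eq_iff_eq_mul.1 this
    rw [this]; simp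

lemma PSL_mk_neg (A : SLZ) : (QuotientGroup.mk (-A) : PSL(2, ℤ)) = QuotientGroup.mk A := by
  rw [QuotientGroup.eq, Matrix.SpecialLinearGroup.mem_center_iff]
  refine ⟨-1, by simp, ?_⟩
  have : (-A)⁻¹ * A = -1 := by
    rw [inv_mul_eq_iff_eq_mul]; simp
  rw [this]
  ext i j
  fin_cases i <;> fin_cases j <;> simp

lemma trace_neg' (A : SLZ) : Matrix.trace (-A).1 = - Matrix.trace A.1 := by
  rw [SLZ_tr, SLZ_tr]; simp; ring

lemma formOf_neg (A : SLZ) : formOf (-A) = smulForm (-1) (formOf A) := by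
  simp [formOf, smulForm]; ring

lemma prim_of_bezout {f : ℤ × ℤ × ℤ} {x y z : ℤ} (h : x * f.1 + y * f.2.1 + z * f.2.2 = 1) :
    IsPrimitiveForm f := by
  unfold IsPrimitiveForm
  have h1 : ((Int.gcd f.1 (Int.gcd f.2.1 f.2.2) : ℕ) : ℤ) ∣ f.1 := Int.gcd_dvd_left _ _
  have h2 : ((Int.gcd f.1 (Int.gcd f.2.1 f.2.2) : ℕ) : ℤ) ∣ Int.gcd f.2.1 f.2.2 :=
    Int.gcd_dvd_right _ _
  have h3 := h2.trans (Int.gcd_dvd_left _ _)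
  have h4 := h2.trans (Int.gcd_dvd_right _ _)
  have h5 : ((Int.gcd f.1 (Int.gcd f.2.1 f.2.2) : ℕ) : ℤ) ∣ 1 := by
    rw [← h]
    exact dvd_add (dvd_add (h1.mul_left _) (h3.mul_left _)) (h4.mul_left _)
  have h6 := Int.eq_one_of_dvd_one (by positivity) h5
  exact_mod_cast h6

lemma exists_shift (a b : ℤ) (ha : a ≠ 0) : ∃ k : ℤ, |b + 2 * a * k| ≤ |a| := by
  have hpos : 0 < |a| := abs_pos.2 ha
  have h1 := Int.emod_nonneg (b + |a|) (by positivity : 2 * |a| ≠ 0)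
  have h2 := Int.emod_lt_of_pos (b + |a|) (by positivity : 0 < 2 * |a|)
  have h3 := Int.emod_add_mul_ediv (b + |a|) (2 * |a|)
  generalize (b + |a|) / (2 * |a|) = q at *
  generalize (b + |a|) % (2 * |a|) = r at *
  rcases abs_choice a with h | h
  · refine ⟨-q, ?_⟩
    rw [abs_le]
    have h4 : a * q = |a| * q := by rw [h]
    constructor <;> linarith
  · refine ⟨q, ?_⟩
    rw [abs_le]
    have h4 : a * q = -(|a| * q) := by rw [h]; ring
    constructor <;> linarith

lemma reduced_bound {a b c d : ℤ} (hd : 0 < d) (ha : a ≠ 0) (h : b ^ 2 - 4 * a * c = d)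
    (h1 : |b| ≤ |a|) (h2 : |a| ≤ |c|) : |a| ≤ d ∧ |b| ≤ d ∧ |c| ≤ d := by
  have hpos : 0 < |a| := abs_pos.2 ha
  have hb : b ^ 2 = |b| ^ 2 := (sq_abs b).symm
  have hb0 := abs_nonneg b
  have hac : |a * c| = |a| * |c| := abs_mul a c
  rcases abs_choice (a * c) with e | e
  · exfalso
    have : a * c = |a| * |c| := by rw [← hac, e]
    nlinarith
  · have : -(a * c) = |a| * |c| := by rw [← hac, e]
    have hcd : |c| ≤ d := by nlinarith
    exact ⟨by linarith, by linarith, hcd⟩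

lemma finite_classes (d : ℤ) (hd : 0 < d) (hns : ∀ s : ℤ, s ^ 2 ≠ d) :
    Finite (Quot (fun f g : {f : ℤ × ℤ × ℤ // IsPrimitiveForm f ∧ formDisc f = d} =>
      formEquiv f.1 g.1)) := by
  set X := {f : ℤ × ℤ × ℤ // IsPrimitiveForm f ∧ formDisc f = d} with hX
  have fin : Finite {x : X // |x.1.1| ≤ d ∧ |x.1.2.1| ≤ d ∧ |x.1.2.2| ≤ d} := by
    have : Finite (Set.Icc ((-d, -d, -d) : ℤ × ℤ × ℤ) (d, d, d)) := (Set.finite_Icc _ _)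
    refine Finite.of_injective (β := Set.Icc ((-d, -d, -d) : ℤ × ℤ × ℤ) (d, d, d))
      (fun x => ⟨x.1.1, ?_⟩) ?_
    · obtain ⟨x, h1, h2, h3⟩ := x
      rw [abs_le] at h1 h2 h3
      exact ⟨⟨h1.1, h2.1, h3.1⟩, ⟨h1.2, h2.2, h3.2⟩⟩
    · intro x y h
      simp only [Subtype.mk.injEq] at h
      exact Subtype.ext (Subtype.ext h)
  refine Finite.of_surjective
    (fun x : {x : X // |x.1.1| ≤ d ∧ |x.1.2.1| ≤ d ∧ |x.1.2.2| ≤ d} => Quot.mk _ x.1) ?_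
  intro q
  obtain ⟨x, hx, hmin⟩ := (measure (fun x : X => x.1.1.natAbs)).wf.has_min
    {x : X | Quot.mk _ x = q} (Quot.exists_rep q)
  obtain ⟨⟨a, b, c⟩, hp, hdisc⟩ := x
  have hdisc' : b ^ 2 - 4 * a * c = d := hdisc
  have ha : a ≠ 0 := by
    rintro rfl
    exact hns b (by linarith)
  obtain ⟨k, hk⟩ := exists_shift a b ha
  obtain ⟨x, y, z, hb⟩ := prim_bezout hp
  simp only at hb
  -- translated form
  have hpt : IsPrimitiveForm (a, b + 2 * a * k, a * k ^ 2 + b * k + c) :=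
    prim_of_bezout (x := x - 2 * k * y + k ^ 2 * z) (y := y - k * z) (z := z)
      (by simp only; linear_combination hb)
  have hdt : formDisc (a, b + 2 * a * k, a * k ^ 2 + b * k + c) = d := by
    simp only [formDisc]; linear_combination hdisc'
  have hps : IsPrimitiveForm (a * k ^ 2 + b * k + c, -(b + 2 * a * k), a) :=
    prim_of_bezout (x := z) (y := -(y - k * z)) (z := x - 2 * k * y + k ^ 2 * z)
      (by simp only; linear_combination hb)
  have hds : formDisc (a * k ^ 2 + b * k + c, -(b + 2 * a * k), a) = d := by
    simp only [formDisc]; linear_combination hdisc'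
  have et : (Quot.mk _ (⟨(a, b, c), hp, hdisc⟩ : X) : Quot (fun f g : X => formEquiv f.1 g.1))
      = Quot.mk _ (⟨(a, b + 2 * a * k, a * k ^ 2 + b * k + c), hpt, hdt⟩ : X) := by
    apply Quot.sound
    refine ⟨⟨!![1, k; 0, 1], by simp⟩, ?_⟩
    intro x y
    simp [formVal]
    ring
  have es : (Quot.mk _ (⟨(a, b, c), hp, hdisc⟩ : X) : Quot (fun f g : X => formEquiv f.1 g.1))
      = Quot.mk _ (⟨(a * k ^ 2 + b * k + c, -(b + 2 * a * k), a), hps, hds⟩ : X) := by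
    apply Quot.sound
    refine ⟨⟨!![k, -1; 1, 0], by simp⟩, ?_⟩
    intro x y
    simp [formVal]
    ring
  have hle : |a| ≤ |a * k ^ 2 + b * k + c| := by
    have := hmin ⟨(a * k ^ 2 + b * k + c, -(b + 2 * a * k), a), hps, hds⟩ (es.symm.trans hx)
    have h2 : ¬ ((a * k ^ 2 + b * k + c).natAbs < a.natAbs) := this
    rw [Int.abs_eq_natAbs, Int.abs_eq_natAbs]
    omega
  exact ⟨⟨⟨(a, b + 2 * a * k, a * k ^ 2 + b * k + c), hpt, hdt⟩,
    reduced_bound hd ha hdt hk hle⟩, et.symm.trans hx⟩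

/-- Chebyshev type sequence -/
def pseq (t : ℤ) : ℕ → ℤ
  | 0 => 0
  | 1 => 1
  | (k + 2) => t * pseq t (k + 1) - pseq t k

lemma formOf_mul_mul (D E : SLZ) : formOf (D * (D * E)) =
    ((Matrix.trace D.1) * (formOf (D * E)).1 - (formOf E).1,
     (Matrix.trace D.1) * (formOf (D * E)).2.1 - (formOf E).2.1,
     (Matrix.trace D.1) * (formOf (D * E)).2.2 - (formOf E).2.2) := by
  have h := SLZ_det D
  simp only [formOf, SLZ_tr, SLZ_mul, Prod.mk.injEq]
  refine ⟨?_, ?_, ?_⟩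
  · linear_combination (-E.1 1 0) * h
  · linear_combination (-E.1 1 1 + E.1 0 0) * h
  · linear_combination (E.1 0 1) * h

lemma formOf_pow (D : SLZ) (k : ℕ) :
    formOf (D ^ k) = smulForm (pseq (Matrix.trace D.1) k) (formOf D) := by
  induction k using Nat.strong_induction_on with
  | _ k ih =>
    match k with
    | 0 => simp [formOf, smulForm, pseq]
    | 1 => simp [formOf, smulForm, pseq]
    | k + 2 =>
      have h1 := ih k (by omega)
      have h2 := ih (k + 1) (by omega)
      have e : D ^ (k + 2) = D * (D * D ^ k) := by rw [← pow_succ', ← pow_succ']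
      rw [e, formOf_mul_mul, ← pow_succ', h1, h2]
      simp only [smulForm, pseq, Prod.mk.injEq]
      refine ⟨?_, ?_, ?_⟩ <;> ring

lemma pseq_ge (t : ℤ) (ht : 3 ≤ t) (k : ℕ) : (k : ℤ) ≤ pseq t k ∧ pseq t k + 1 ≤ pseq t (k + 1) := by
  induction k with
  | zero => simp [pseq]
  | succ k ih =>
    obtain ⟨h1, h2⟩ := ih
    have : pseq t (k + 1 + 1) = t * pseq t (k + 1) - pseq t k := rfl
    push_cast
    refine ⟨by linarith, ?_⟩
    rw [this]
    have : (0 : ℤ) ≤ k := by positivity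
    nlinarith

lemma td_spec {d : ℤ} {n u : ℕ} (hn : 0 < n) (hu : 0 < u) (h : (n : ℤ) ^ 2 - d * (u : ℤ) ^ 2 = 4) :
    0 < td d ∧ 0 < ud d ∧ (td d : ℤ) ^ 2 - d * (ud d : ℤ) ^ 2 = 4 := by
  have h1 := Nat.sInf_mem (s := {t : ℕ | 0 < t ∧ ∃ u : ℕ, 0 < u ∧ (t : ℤ) ^ 2 - d * (u : ℤ) ^ 2 = 4})
    ⟨n, hn, u, hu, h⟩
  obtain ⟨h1, h2⟩ := h1
  have h3 := Nat.sInf_mem (s := {u : ℕ | 0 < u ∧ (td d : ℤ) ^ 2 - d * (u : ℤ) ^ 2 = 4}) h2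
  exact ⟨h1, h3.1, h3.2⟩

lemma td_le {d : ℤ} {n u : ℕ} (hn : 0 < n) (hu : 0 < u) (h : (n : ℤ) ^ 2 - d * (u : ℤ) ^ 2 = 4) :
    td d ≤ n := Nat.sInf_le ⟨hn, u, hu, h⟩

lemma td_le' {d : ℤ} {n u : ℤ} (hn : 0 < n) (hu : u ≠ 0) (h : n ^ 2 - d * u ^ 2 = 4) :
    (td d : ℤ) ≤ n := by
  have := td_le (d := d) (n := n.natAbs) (u := u.natAbs) (by omega) (by omega) (by simpa using h)
  omega

lemma smulForm_smul (a b : ℤ) (f : ℤ × ℤ × ℤ) :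
    smulForm a (smulForm b f) = smulForm (a * b) f := by
  simp only [smulForm, mul_assoc]

lemma smulForm_cancel {a : ℤ} (ha : a ≠ 0) {f g : ℤ × ℤ × ℤ} (h : smulForm a f = smulForm a g) :
    f = g := by
  simp only [smulForm, Prod.mk.injEq, mul_right_inj' ha] at h
  exact Prod.ext h.1 (Prod.ext h.2.1 h.2.2)

lemma exists_lift (γ : PSL(2, ℤ)) :
    ∃ A : SLZ, (QuotientGroup.mk A : PSL(2, ℤ)) = γ ∧ 0 ≤ Matrix.trace A.1 := by
  obtain ⟨A, rfl⟩ := QuotientGroup.mk_surjective γ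
  rcases le_total 0 (Matrix.trace A.1) with h | h
  · exact ⟨A, rfl, h⟩
  · exact ⟨-A, PSL_mk_neg A, by rw [trace_neg']; linarith⟩

lemma prim_of_td {f : ℤ × ℤ × ℤ} (hf : IsPrimitiveForm f) {d : ℤ} (hfd : formDisc f = d)
    (hd : 0 < d) {P : SLZ} (hu : 0 < ud d)
    (heq : (td d : ℤ) ^ 2 - d * (ud d : ℤ) ^ 2 = 4) (hP : formOf P = smulForm (ud d) f) :
    PSLPrimitive (QuotientGroup.mk P : PSL(2, ℤ)) := by
  intro δ k hk h
  obtain ⟨D, rfl, hD⟩ := exists_lift δ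
  have h' : (QuotientGroup.mk P : PSL(2, ℤ)) = QuotientGroup.mk (D ^ k) := h
  obtain ⟨p, hp, hpk⟩ : ∃ p : ℤ, formOf P = smulForm p (formOf D) ∧
      p ^ 2 = (pseq (Matrix.trace D.1) k) ^ 2 := by
    rcases PSL_mk_eq h' with e | e
    · exact ⟨_, by rw [e, formOf_pow], rfl⟩
    · exact ⟨-1 * pseq (Matrix.trace D.1) k, by
        rw [e, formOf_neg, formOf_pow, smulForm_smul], by ring⟩
  have e := hP.symm.trans hp
  obtain ⟨w, hw⟩ : p ∣ (ud d : ℤ) := by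
    apply dvd_of_prim hf
    intro x y
    rw [← formVal_smul, e, formVal_smul]
    exact dvd_mul_right _ _
  have hu' : (0 : ℤ) < ud d := by exact_mod_cast hu
  have hp0 : p ≠ 0 := by rintro rfl; simp at hw; omega
  have hw0 : w ≠ 0 := by rintro rfl; simp at hw; omega
  have hDf : formOf D = smulForm w f := by
    apply smulForm_cancel hp0
    rw [smulForm_smul, ← hw, e]
  have hdD := disc_eq hDf
  rw [hfd] at hdD
  have hw2 : 0 < w ^ 2 := by positivity
  have hdw : 0 < d * w ^ 2 := by positivity
  have ht : 3 ≤ Matrix.trace D.1 := by nlinarith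
  have hle := td_le' (by linarith) hw0 hdD
  have hk2 := (pseq_ge _ ht k).1
  have h1 : p ^ 2 ≤ 1 := by
    have : (td d : ℤ) ^ 2 ≤ (Matrix.trace D.1) ^ 2 := by
      have : (0 : ℤ) ≤ td d := by positivity
      nlinarith
    rw [hw] at heq
    have h2 : (d * w ^ 2) * p ^ 2 ≤ (d * w ^ 2) * 1 := by nlinarith
    exact le_of_mul_le_mul_left h2 hdw
  have h3 : (k : ℤ) ^ 2 ≤ 1 := by
    have : (0 : ℤ) ≤ k := by positivity
    nlinarith
  have h4 : k ^ 2 ≤ 1 := by exact_mod_cast h3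
  nlinarith

lemma descent {d u t T U : ℤ} (hd : 0 < d) (hu : 0 < u) (ht : 0 < t) (hT : 0 < T) (hU : 0 < U)
    (hUu : U < u) (h1 : t ^ 2 - d * u ^ 2 = 4) (h2 : T ^ 2 - d * U ^ 2 = 4) :
    d * u * U < t * T ∧ t * U < u * T ∧ u * T - t * U < 2 * u := by
  have e1 : t ^ 2 = 4 + d * u ^ 2 := by linarith
  have e2 : T ^ 2 = 4 + d * U ^ 2 := by linarith
  have p1 : 0 < d * u ^ 2 := by positivity
  have p2 : 0 < d * U ^ 2 := by positivity
  refine ⟨?_, ?_, ?_⟩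
  · apply lt_of_pow_lt_pow_left₀ 2 (by positivity)
    rw [mul_pow t, e1, e2]
    linarith [show (4 + d * u ^ 2) * (4 + d * U ^ 2) =
      16 + 4 * (d * u ^ 2) + 4 * (d * U ^ 2) + (d * u * U) ^ 2 by ring]
  · apply lt_of_pow_lt_pow_left₀ 2 (by positivity)
    rw [mul_pow t, mul_pow _ T, e1, e2]
    have : U ^ 2 < u ^ 2 := by nlinarith
    linarith [show (4 + d * u ^ 2) * U ^ 2 = u ^ 2 * (4 + d * U ^ 2) - 4 * (u ^ 2 - U ^ 2) by ring]
  · have hT3 : 3 ≤ T := by nlinarith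
    have : u * (T - 2) < t * U := by
      apply lt_of_pow_lt_pow_left₀ 2 (by positivity)
      have e3 : (t * U) ^ 2 = 4 * U ^ 2 + u ^ 2 * (T ^ 2 - 4) := by
        rw [mul_pow, e1, e2]; ring
      rw [e3, mul_pow]
      have : 0 < U ^ 2 := by positivity
      have : (u : ℤ) ^ 2 * (T - 2) ^ 2 ≤ u ^ 2 * (T ^ 2 - 4) := by
        apply mul_le_mul_of_nonneg_left _ (by positivity)
        nlinarith
      linarith
    linarith

lemma pow_of_td {f : ℤ × ℤ × ℤ} {d : ℤ} (hfd : formDisc f = d)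
    (hd : 0 < d) {P : SLZ} (ht0 : 0 < td d) (hu0 : 0 < ud d)
    (heq : (td d : ℤ) ^ 2 - d * (ud d : ℤ) ^ 2 = 4) (hP : formOf P = smulForm (ud d) f)
    (htP : Matrix.trace P.1 = td d) (u : ℕ) : ∀ (A : SLZ), 0 < u → formOf A = smulForm u f →
      0 < Matrix.trace A.1 → ∃ k : ℕ, 1 ≤ k ∧ A = P ^ k := by
  induction u using Nat.strong_induction_on with
  | _ u ih =>
    intro A hu hA htA
    obtain ⟨t, ht⟩ : ∃ t, t = Matrix.trace A.1 := ⟨_, rfl⟩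
    rw [← ht] at htA
    have hdA := disc_eq hA
    rw [hfd, ← ht] at hdA
    have hu' : (0 : ℤ) < u := by exact_mod_cast hu
    have hle := td_le' htA hu'.ne' hdA
    obtain ⟨T, hT⟩ : ∃ T : ℤ, T = td d := ⟨_, rfl⟩
    obtain ⟨U, hU⟩ : ∃ U : ℤ, U = ud d := ⟨_, rfl⟩
    have hT0 : 0 < T := by rw [hT]; exact_mod_cast ht0
    have hU0 : 0 < U := by rw [hU]; exact_mod_cast hu0
    rw [← hT, ← hU] at heq
    rw [← hT] at hle htP
    rw [← hU] at hP
    rcases hle.eq_or_lt with h | h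
    · refine ⟨1, le_rfl, ?_⟩
      rw [pow_one]
      have : (u : ℤ) = U := by
        have h2 : d * (u : ℤ) ^ 2 = d * U ^ 2 := by rw [h] at heq; linarith
        have h3 := mul_left_cancel₀ hd.ne' h2
        exact (sq_eq_sq₀ hu'.le hU0.le).1 h3
      apply SLZ_ext
      · rw [hA, hP, this]
      · rw [htP, ← ht, h]
    · have hUu : U < u := by
        by_contra hcon
        push Not at hcon
        have : (u : ℤ) ^ 2 ≤ U ^ 2 := by nlinarith
        have : d * (u : ℤ) ^ 2 ≤ d * U ^ 2 := by nlinarith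
        nlinarith
      have hdf := hfd
      simp only [formDisc] at hdf
      obtain ⟨a, b, c⟩ := f
      simp only [formOf, smulForm, Prod.mk.injEq] at hA hP
      simp only at hdf
      obtain ⟨a1, a2, a3⟩ := hA
      obtain ⟨p1, p2, p3⟩ := hP
      rw [SLZ_tr] at ht htP
      -- v
      have hv : ∃ v : ℤ, 2 * v = u * T - t * U := by
        refine ⟨u * P.1 0 0 - U * A.1 0 0, ?_⟩
        rw [ht, ← htP]
        linear_combination U * a2 - u * p2
      obtain ⟨v, hv⟩ := hv
      have hvf : formOf (A * P⁻¹) = smulForm v (a, b, c) := by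
        have e1 : 2 * A.1 0 0 = t - u * b := by linarith
        have e2 : 2 * A.1 1 1 = t + u * b := by linarith
        have e3 : A.1 0 1 = -(u * c) := by linarith
        have f1 : 2 * P.1 0 0 = T - U * b := by linarith
        have f2 : 2 * P.1 1 1 = T + U * b := by linarith
        have f3 : P.1 0 1 = -(U * c) := by linarith
        simp only [formOf, smulForm, SLZ_mul, SLZ_inv00, SLZ_inv01, SLZ_inv10, SLZ_inv11,
          Prod.mk.injEq]
        rw [a1, p1, e3, f3]
        refine ⟨?_, ?_, ?_⟩
        · have : 2 * (u * a * P.1 1 1 + A.1 1 1 * -(U * a)) = 2 * (v * a) := by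
            linear_combination u * a * f2 - U * a * e2 - a * hv
          linarith
        · have : 4 * (u * a * - -(U * c) + A.1 1 1 * P.1 0 0
              - (A.1 0 0 * P.1 1 1 + -(u * c) * -(U * a))) = 4 * (v * b) := by
            linear_combination 2 * P.1 0 0 * e2 + (t + u * b) * f1 - 2 * P.1 1 1 * e1
              - (t - u * b) * f2 - 2 * b * hv
          linarith
        · have : 2 * -(A.1 0 0 * - -(U * c) + -(u * c) * P.1 0 0) = 2 * (v * c) := by
            linear_combination - U * c * e1 + u * c * f1 - c * hv
          linarith
      have hvt : 2 * Matrix.trace (A * P⁻¹).1 = t * T - d * u * U := by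
        have e1 : 2 * A.1 0 0 = t - u * b := by linarith
        have e2 : 2 * A.1 1 1 = t + u * b := by linarith
        have e3 : A.1 0 1 = -(u * c) := by linarith
        have f1 : 2 * P.1 0 0 = T - U * b := by linarith
        have f2 : 2 * P.1 1 1 = T + U * b := by linarith
        have f3 : P.1 0 1 = -(U * c) := by linarith
        simp only [SLZ_tr, SLZ_mul, SLZ_inv00, SLZ_inv01, SLZ_inv10, SLZ_inv11]
        rw [a1, p1, e3, f3, ← hdf]
        have : 2 * (2 * (A.1 0 0 * P.1 1 1 + -(u * c) * -(U * a) + (u * a * - -(U * c) + A.1 1 1 * P.1 0 0)))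
          = 2 * (t * T - (b ^ 2 - 4 * a * c) * u * U) := by
          linear_combination 2 * P.1 0 0 * e2 + (t + u * b) * f1 + 2 * P.1 1 1 * e1
              + (t - u * b) * f2
        linarith
      obtain ⟨q1, q2, q3⟩ := descent hd hu' htA hT0 hU0 hUu hdA heq
      have htpos : 0 < Matrix.trace (A * P⁻¹).1 := by linarith
      have hvpos : 0 < v := by linarith
      have hvu : v < u := by linarith
      lift v to ℕ using hvpos.le
      obtain ⟨k, hk, e⟩ := ih v (by exact_mod_cast hvu) (A * P⁻¹) (by exact_mod_cast hvpos) hvf htpos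
      refine ⟨k + 1, by omega, ?_⟩
      rw [pow_succ, ← e]
      group

lemma sqrt_Nnorm {n : ℕ} (hn : 2 < n) :
    Real.sqrt (Nnorm n) - (Real.sqrt (Nnorm n))⁻¹ = Real.sqrt ((n : ℝ) ^ 2 - 4) := by
  unfold Nnorm
  have hn' : (2 : ℝ) < n := by exact_mod_cast hn
  have hs : Real.sqrt ((n : ℝ) ^ 2 - 4) ^ 2 = (n : ℝ) ^ 2 - 4 := Real.sq_sqrt (by nlinarith)
  have hs0 := Real.sqrt_nonneg ((n : ℝ) ^ 2 - 4)
  rw [Real.sqrt_sq (by positivity)]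
  have : (n : ℝ) + Real.sqrt ((n : ℝ) ^ 2 - 4) ≠ 0 := by positivity
  field_simp
  nlinarith

lemma weight_eq {n : ℕ} (hn : 2 < n)
    (W : ConjClasses PSL(2, ℤ) → ℝ)
    (hW : ∀ (P₀ : PSL(2, ℤ)) (k : ℕ), 1 ≤ k → PSLPrimitive P₀ →
      ∀ m₀ m : ℕ, PSLTraceAbs P₀ m₀ → PSLTraceAbs (P₀ ^ k) m → 2 < m →
        W (ConjClasses.mk (P₀ ^ k)) =
          Real.log (Nnorm m₀) / (Real.sqrt (Nnorm m) - (Real.sqrt (Nnorm m))⁻¹))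
    {f : ℤ × ℤ × ℤ} (hf : IsPrimitiveForm f) {d u : ℕ} (hfd : formDisc f = d)
    (hd : 0 < d) (hu : 0 < u) {A : SLZ} (hA : formOf A = smulForm u f)
    (htA : Matrix.trace A.1 = n) :
    (1 / 2) * W (ConjClasses.mk (QuotientGroup.mk A : PSL(2, ℤ))) =
      Real.log (eps (d : ℤ)) / ((u : ℝ) * Real.sqrt (d : ℝ)) := by
  have hdA := disc_eq hA
  rw [hfd, htA] at hdA
  obtain ⟨ht0, hu0, heq⟩ := td_spec (by omega) hu hdA
  obtain ⟨P, hP, htP⟩ := exists_mat f (td d) (ud d) (by rw [hfd]; exact heq)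
  have hd' : (0 : ℤ) < d := by exact_mod_cast hd
  have hprim := prim_of_td hf hfd hd' hu0 heq hP
  obtain ⟨k, hk, e⟩ := pow_of_td hfd hd' ht0 hu0 heq hP htP u A hu hA (by rw [htA]; omega)
  have e' : (QuotientGroup.mk A : PSL(2, ℤ)) = (QuotientGroup.mk P : PSL(2, ℤ)) ^ k := by
    rw [e]; rfl
  have key := hW (QuotientGroup.mk P) k hk hprim (td d) n ⟨P, rfl, by rw [htP]; simp⟩
    ⟨A, e', by rw [htA]; simp⟩ hn
  rw [e', key, sqrt_Nnorm hn]
  have r1 : ((n : ℝ) ^ 2 - 4) = (u : ℝ) ^ 2 * d := by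
    have : ((n : ℝ) ^ 2 - (d : ℝ) * (u : ℝ) ^ 2) = 4 := by exact_mod_cast hdA
    linarith
  have r2 : ((td d : ℝ) ^ 2 - 4) = (ud d : ℝ) ^ 2 * d := by
    have : ((td d : ℝ) ^ 2 - (d : ℝ) * (ud d : ℝ) ^ 2) = 4 := by exact_mod_cast heq
    linarith
  rw [r1, Real.sqrt_mul (by positivity), Real.sqrt_sq (by positivity)]
  have : Nnorm (td d) = eps d ^ 2 := by
    unfold Nnorm eps
    rw [r2, Real.sqrt_mul (by positivity), Real.sqrt_sq (by positivity)]
    simp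
  rw [this, Real.log_pow]
  push_cast
  ring

lemma content_dvd {f g : ℤ × ℤ × ℤ} (hg : IsPrimitiveForm g) {u v : ℤ}
    {A B M : SLZ} (hA : formOf A = smulForm u f) (hB : formOf B = smulForm v g)
    (h : M⁻¹ * A * M = B) : u ∣ v := by
  apply dvd_of_prim hg
  intro x y
  rw [← formVal_smul, ← hB, ← h, formVal_conj, hA, formVal_smul]
  exact dvd_mul_right _ _

lemma conj_forms {f g : ℤ × ℤ × ℤ} (hf : IsPrimitiveForm f) (hg : IsPrimitiveForm g) {u v n : ℕ}
    (hu : 0 < u) (hn : 0 < n)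
    {A B : SLZ} (hA : formOf A = smulForm u f) (hB : formOf B = smulForm v g)
    (htA : Matrix.trace A.1 = n) (htB : Matrix.trace B.1 = n)
    (h : ConjClasses.mk (QuotientGroup.mk A : PSL(2, ℤ)) = ConjClasses.mk (QuotientGroup.mk B)) :
    u = v ∧ formEquiv f g := by
  rw [ConjClasses.mk_eq_mk_iff_isConj, isConj_iff] at h
  obtain ⟨c, hc⟩ := h
  obtain ⟨M, rfl⟩ := QuotientGroup.mk_surjective c
  have hc' : (QuotientGroup.mk (M * A * M⁻¹) : PSL(2, ℤ)) = QuotientGroup.mk B := hc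
  have htr : Matrix.trace (M * A * M⁻¹).1 = n := by
    have := trace_conj A M⁻¹
    rwa [inv_inv, htA] at this
  rcases PSL_mk_eq hc' with e | e
  · have e1 : (M⁻¹)⁻¹ * A * M⁻¹ = B := by rw [inv_inv, e]
    have e2 : M⁻¹ * B * M = A := by rw [← e]; group
    have d1 := content_dvd hg hA hB e1
    have d2 := content_dvd hf hB hA e2
    have huv : u = v := Nat.dvd_antisymm (by exact_mod_cast d1) (by exact_mod_cast d2)
    refine ⟨huv, M⁻¹, ?_⟩
    intro x y
    have := formVal_conj A M⁻¹ x y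
    rw [e1, hA, hB, formVal_smul, formVal_smul, ← huv] at this
    exact mul_left_cancel₀ (by exact_mod_cast hu.ne') this
  · exfalso
    rw [e, trace_neg', htB] at htr
    omega

lemma conj_of_equiv {f g : ℤ × ℤ × ℤ} {u : ℤ} {A B : SLZ} (hA : formOf A = smulForm u f)
    (hB : formOf B = smulForm u g) (ht : Matrix.trace A.1 = Matrix.trace B.1)
    (h : formEquiv f g) :
    ConjClasses.mk (QuotientGroup.mk A : PSL(2, ℤ)) = ConjClasses.mk (QuotientGroup.mk B) := by
  obtain ⟨M, hM⟩ := h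
  have := conj_of_form (M := M) ht (by
    intro x y
    rw [hA, hB, formVal_smul, formVal_smul, hM])
  rw [ConjClasses.mk_eq_mk_iff_isConj, isConj_iff]
  refine ⟨QuotientGroup.mk M⁻¹, ?_⟩
  rw [← this]
  have e : M⁻¹ * A * M = M⁻¹ * A * (M⁻¹)⁻¹ := by rw [inv_inv]
  rw [e]
  rfl

/-- **The amplitude as a conjugacy-class sum**: for `n > 2`, the sum
`(1/2)·Σ_{[P] : |tr P| = n} log N(P₀)/(N(P)^{1/2} − N(P)^{−1/2})` over conjugacy classes of
hyperbolic elements of `PSL(2,ℤ)` with `|trace| = n` (where `P = P₀^k`, `P₀` primitive)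
equals `A(n)`. Here `W` is any class function whose value on the class of `P = P₀^k` is the
prescribed weight `log N(|tr P₀|)/(√N(|tr P|) − 1/√N(|tr P|))`. -/
theorem conjugacy_class_sum_eq_ampA
    (n : ℕ) (hn : 2 < n)
    (W : ConjClasses PSL(2, ℤ) → ℝ)
    (hW : ∀ (P₀ : PSL(2, ℤ)) (k : ℕ), 1 ≤ k → PSLPrimitive P₀ →
      ∀ m₀ m : ℕ, PSLTraceAbs P₀ m₀ → PSLTraceAbs (P₀ ^ k) m → 2 < m →
        W (ConjClasses.mk (P₀ ^ k)) =
          Real.log (Nnorm m₀) / (Real.sqrt (Nnorm m) - (Real.sqrt (Nnorm m))⁻¹)) :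
    (1 / 2) * (∑' c : {c : ConjClasses PSL(2, ℤ) //
        ∃ γ : PSL(2, ℤ), ConjClasses.mk γ = c ∧ PSLTraceAbs γ n}, W c.1) = ampA n := by
  classical
  unfold ampA
  set S := (Finset.range (n ^ 2) ×ˢ Finset.range (n ^ 2)).filter
      (fun p => 0 < p.1 ∧ 0 < p.2 ∧ (p.1 % 4 = 0 ∨ p.1 % 4 = 1) ∧ p.1 * p.2 ^ 2 = n ^ 2 - 4) with hS
  have hn4 : 4 < n ^ 2 := by nlinarith
  have hSpos : ∀ p : S, 0 < p.1.1 ∧ 0 < p.1.2 ∧ p.1.1 * p.1.2 ^ 2 = n ^ 2 - 4 := by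
    intro p
    have := (Finset.mem_filter.1 p.2).2
    exact ⟨this.1, this.2.1, this.2.2.2⟩
  have hSeq : ∀ p : S, (n : ℤ) ^ 2 - (p.1.1 : ℤ) * (p.1.2 : ℤ) ^ 2 = 4 := by
    intro p
    have h1 := (hSpos p).2.2
    have h2 : p.1.1 * p.1.2 ^ 2 + 4 = n ^ 2 := by omega
    have h3 : (p.1.1 : ℤ) * (p.1.2 : ℤ) ^ 2 + 4 = (n : ℤ) ^ 2 := by exact_mod_cast h2
    linarith
  let X : S → Type := fun p => {f : ℤ × ℤ × ℤ // IsPrimitiveForm f ∧ formDisc f = (p.1.1 : ℤ)}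
  let Q : S → Type := fun p => Quot (fun f g : X p => formEquiv f.1 g.1)
  have hfin : ∀ p : S, Finite (Q p) := by
    intro p
    apply finite_classes
    · exact_mod_cast (hSpos p).1
    · intro s hs
      have h1 := hSeq p
      rw [← hs] at h1
      have h2 : (n : ℤ) ^ 2 - (|s| * p.1.2) ^ 2 = 4 := by rw [mul_pow, sq_abs]; exact h1
      have h0 : 0 ≤ |s| * (p.1.2 : ℤ) := by positivity
      generalize |s| * (p.1.2 : ℤ) = m at h2 h0
      have hn' : (3 : ℤ) ≤ n := by exact_mod_cast hn
      have h3 : m < n := by nlinarith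
      have h4 : m ≤ n - 1 := by omega
      nlinarith
  have hft : ∀ p : S, Fintype (Q p) := fun p => Fintype.ofFinite _
  have hex : ∀ (p : S) (x : X p), ∃ A : SLZ, formOf A = smulForm p.1.2 x.1 ∧
      Matrix.trace A.1 = n := by
    intro p x
    apply exists_mat
    rw [x.2.2]
    exact hSeq p
  choose M hM1 hM2 using hex
  let F : (Σ p : S, Q p) → {c : ConjClasses PSL(2, ℤ) //
        ∃ γ : PSL(2, ℤ), ConjClasses.mk γ = c ∧ PSLTraceAbs γ n} := fun z =>
    ⟨Quot.lift (fun x => ConjClasses.mk (QuotientGroup.mk (M z.1 x) : PSL(2, ℤ)))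
      (fun x y h => conj_of_equiv (hM1 _ x) (hM1 _ y) ((hM2 _ x).trans (hM2 _ y).symm) h) z.2, by
      obtain ⟨p, q⟩ := z
      induction q using Quot.ind with
      | _ x => exact ⟨_, rfl, M p x, rfl, by rw [hM2]; simp⟩⟩
  have hFinj : Function.Injective F := by
    rintro ⟨p, q⟩ ⟨p', q'⟩ h
    induction q using Quot.ind with
    | _ x =>
    induction q' using Quot.ind with
    | _ y =>
    have h' : ConjClasses.mk (QuotientGroup.mk (M p x) : PSL(2, ℤ)) =
      ConjClasses.mk (QuotientGroup.mk (M p' y) : PSL(2, ℤ)) := congrArg Subtype.val h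
    obtain ⟨huv, hfe⟩ := conj_forms x.2.1 y.2.1 (hSpos p).2.1 (by omega) (hM1 _ _) (hM1 _ _)
      (hM2 _ _) (hM2 _ _) h'
    have hpp : p = p' := by
      apply Subtype.ext
      refine Prod.ext ?_ huv
      have e := (hSpos p).2.2.trans (hSpos p').2.2.symm
      rw [huv] at e
      exact Nat.eq_of_mul_eq_mul_right (pow_pos (hSpos p').2.1 2) e
    subst hpp
    congr 1
    exact Quot.sound hfe
  have hFsurj : Function.Surjective F := by
    rintro ⟨c, γ, rfl, A, rfl, hA⟩
    obtain ⟨B, hB, hBt⟩ : ∃ B : SLZ, (QuotientGroup.mk A : PSL(2, ℤ)) = QuotientGroup.mk B ∧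
        Matrix.trace B.1 = n := by
      rcases le_total 0 (Matrix.trace A.1) with h | h
      · exact ⟨A, rfl, by omega⟩
      · exact ⟨-A, (PSL_mk_neg A).symm, by rw [trace_neg']; omega⟩
    have hdB := disc_eq (A := B) (f := formOf B) (u := 1) (by simp [smulForm])
    rw [hBt] at hdB
    have hn4' : (4 : ℤ) < (n : ℤ) ^ 2 := by exact_mod_cast hn4
    obtain ⟨u, f, hu, hf, hfu⟩ := content (g := formOf B) (by intro h; rw [h] at hdB; linarith)
    have hd2 := disc_eq hfu
    rw [hBt] at hd2
    have hdpos : 0 < formDisc f := by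
      by_contra hcon
      push Not at hcon
      have : (0 : ℤ) ≤ (u : ℤ) ^ 2 := by positivity
      nlinarith
    obtain ⟨d, hd⟩ : ∃ d : ℕ, formDisc f = d := ⟨_, (Int.toNat_of_nonneg hdpos.le).symm⟩
    have hd0 : 0 < d := by rw [hd] at hdpos; exact_mod_cast hdpos
    have hdu : d * u ^ 2 = n ^ 2 - 4 := by
      have h1 : (d : ℤ) * (u : ℤ) ^ 2 + 4 = (n : ℤ) ^ 2 := by rw [hd] at hd2; linarith
      have h2 : d * u ^ 2 + 4 = n ^ 2 := by exact_mod_cast h1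
      omega
    have hmod : d % 4 = 0 ∨ d % 4 = 1 := by
      have h1 : (d : ℤ) = f.2.1 ^ 2 - 4 * (f.1 * f.2.2) := by rw [← hd, formDisc]; ring
      rcases Int.emod_two_eq_zero_or_one f.2.1 with h | h
      · obtain ⟨m, hm⟩ : ∃ m, f.2.1 = 2 * m := ⟨f.2.1 / 2, by omega⟩
        have : (d : ℤ) = 4 * (m ^ 2 - f.1 * f.2.2) := by rw [h1, hm]; ring
        omega
      · obtain ⟨m, hm⟩ : ∃ m, f.2.1 = 2 * m + 1 := ⟨f.2.1 / 2, by omega⟩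
        have : (d : ℤ) = 4 * (m ^ 2 + m - f.1 * f.2.2) + 1 := by rw [h1, hm]; ring
        omega
    have hmem : (d, u) ∈ S := by
      rw [hS, Finset.mem_filter, Finset.mem_product, Finset.mem_range, Finset.mem_range]
      have h1 : d ≤ d * u ^ 2 := Nat.le_mul_of_pos_right _ (by positivity)
      have h2 : u ^ 2 ≤ d * u ^ 2 := Nat.le_mul_of_pos_left _ hd0
      have h3 : u ≤ u ^ 2 := Nat.le_self_pow (by norm_num) u
      exact ⟨⟨by simp only; omega, by simp only; omega⟩, hd0, hu, hmod, hdu⟩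
    refine ⟨⟨⟨(d, u), hmem⟩, Quot.mk _ ⟨f, hf, hd⟩⟩, ?_⟩
    apply Subtype.ext
    change ConjClasses.mk (QuotientGroup.mk (M ⟨(d, u), hmem⟩ ⟨f, hf, hd⟩) : PSL(2, ℤ)) =
      ConjClasses.mk (QuotientGroup.mk A : PSL(2, ℤ))
    rw [hB]
    congr 2
    apply SLZ_ext
    · rw [hM1, hfu]
    · rw [hM2, hBt]
  rw [← (Equiv.ofBijective F ⟨hFinj, hFsurj⟩).tsum_eq, tsum_fintype, Finset.mul_sum,
    Fintype.sum_sigma, ← Finset.sum_coe_sort S]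
  apply Finset.sum_congr rfl
  intro p _
  have hw : ∀ q : Q p, 1 / 2 * W ((Equiv.ofBijective F ⟨hFinj, hFsurj⟩) ⟨p, q⟩).1 =
      Real.log (eps (p.1.1 : ℤ)) / ((p.1.2 : ℝ) * Real.sqrt (p.1.1 : ℝ)) := by
    intro q
    induction q using Quot.ind with
    | _ x =>
    exact weight_eq hn W hW x.2.1 x.2.2 (hSpos p).1 (hSpos p).2.1 (hM1 p x) (hM2 p x)
  rw [Finset.sum_congr rfl (fun q _ => hw q), Finset.sum_const, Finset.card_univ, nsmul_eq_mul]
  have hcard : classNumber (p.1.1 : ℤ) = Fintype.card (Q p) := by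
    rw [← Nat.card_eq_fintype_card]
    rfl
  rw [hcard, mul_div_assoc]
end
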